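/- Under the Algorithm 1 setup with every Φ_{i,t} equal to the identity mapping, with each f_{i,t} being μ_i-strongly convex over X_i with respect to ψ_i (μ_i > 0), and with stepsizes α_t = 1/t^{max{1−κ,κ}}, β_t = 1/t^κ, γ_t = 1/t^{1−κ} for a constant κ ∈ (0,1), for any T ∈ ℕ₊ the sequence x_T generated by Algorithm 1 satisfies ‖[Σ_{t=1}^T g_t(x_t)]_+‖ ≤ √(C₂) T^{1−κ/2}, where [·]_+ is the componentwise positive part, C₂ = C_{2,1}(2nF + C₁) with c = max{1−κ,κ}, C_{2,1} = 2n(2G²/((1−c)σ̲) + 1/(1−κ) + 2), C₁ = C_{1,1}/κ + C_{1,2}/(1−c) + 2n·d(X)·K, C_{1,1} = 3n²τB₁F/(1−λ) + nB₁²/2, C_{1,2} = 4nG²/σ̲, τ = (1 − w/(2n²))^{−2}, λ = (1 − w/(2n²))^{1/ι}, and B₁ = 2F + G·d(X). -/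

import Mathlib

open scoped RealInnerProductSpace

noncomputable section

/-- Bregman divergence generated by `ψ` with gradient map `ψ'`. -/
def breg {d : ℕ} (ψ : EuclideanSpace ℝ (Fin d) → ℝ)
    (ψ' : EuclideanSpace ℝ (Fin d) → EuclideanSpace ℝ (Fin d))
    (x y : EuclideanSpace ℝ (Fin d)) : ℝ :=
  ψ x - ψ y - ⟪ψ' y, x - y⟫

/-- Componentwise positive part `[v]₊`. -/
def posPart {d : ℕ} (v : EuclideanSpace ℝ (Fin d)) : EuclideanSpace ℝ (Fin d) :=
  (WithLp.equiv 2 (Fin d → ℝ)).symm fun j => max (v j) 0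

/-- Build a Euclidean vector from a coordinate function. -/
def vecOf {d : ℕ} (v : Fin d → ℝ) : EuclideanSpace ℝ (Fin d) :=
  (WithLp.equiv 2 (Fin d → ℝ)).symm v

/-- Stack a family of per-agent vectors into the Euclidean product space. -/
def stack {n : ℕ} {p : Fin n → ℕ} (y : ∀ i, EuclideanSpace ℝ (Fin (p i))) :
    PiLp 2 (fun i => EuclideanSpace ℝ (Fin (p i))) :=
  (WithLp.equiv 2 (∀ i, EuclideanSpace ℝ (Fin (p i)))).symm y

/-- The setup and iterates of Algorithm 1 (distributed online primal-dual
dynamic mirror descent) of the paper. -/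
structure Alg (n m : ℕ) (p : Fin n → ℕ) where
  hn : 0 < n
  hm : 0 < m
  X : ∀ i : Fin n, Set (EuclideanSpace ℝ (Fin (p i)))
  hXconvex : ∀ i, Convex ℝ (X i)
  hXcompact : ∀ i, IsCompact (X i)
  hXnonempty : ∀ i, (X i).Nonempty
  dX : ℝ
  hdX : 0 < dX
  hdiam : ∀ u v : PiLp 2 (fun i => EuclideanSpace ℝ (Fin (p i))),
    (∀ i, u i ∈ X i) → (∀ i, v i ∈ X i) → ‖u - v‖ ≤ dX
  f : ℕ → ∀ i : Fin n, EuclideanSpace ℝ (Fin (p i)) → ℝ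
  r : ℕ → ∀ i : Fin n, EuclideanSpace ℝ (Fin (p i)) → ℝ
  g : ℕ → ∀ i : Fin n, EuclideanSpace ℝ (Fin (p i)) → EuclideanSpace ℝ (Fin m)
  hf0 : ∀ i z, f 0 i z = 0
  hr0 : ∀ i z, r 0 i z = 0
  hg0 : ∀ i z, g 0 i z = 0
  hfconvex : ∀ t i, ConvexOn ℝ (X i) (f t i)
  hrconvex : ∀ t i, ConvexOn ℝ (X i) (r t i)
  hgconvex : ∀ t i (j : Fin m), ConvexOn ℝ (X i) (fun z => g t i z j)
  F : ℝ
  hF : 0 < F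
  G : ℝ
  hG : 0 < G
  hfbound : ∀ t i, ∀ z ∈ X i, |f t i z| ≤ F
  hrbound : ∀ t i, ∀ z ∈ X i, |r t i z| ≤ F
  hgbound : ∀ t i, ∀ z ∈ X i, ‖g t i z‖ ≤ F
  Gf : ℕ → ∀ i : Fin n, EuclideanSpace ℝ (Fin (p i)) → EuclideanSpace ℝ (Fin (p i))
  Gr : ℕ → ∀ i : Fin n, EuclideanSpace ℝ (Fin (p i)) → EuclideanSpace ℝ (Fin (p i))
  Gg : ℕ → ∀ i : Fin n, EuclideanSpace ℝ (Fin (p i)) → Fin m → EuclideanSpace ℝ (Fin (p i))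
  hGfsub : ∀ t i, ∀ z ∈ X i, ∀ u ∈ X i, f t i z + ⟪Gf t i z, u - z⟫ ≤ f t i u
  hGrsub : ∀ t i, ∀ z ∈ X i, ∀ u ∈ X i, r t i z + ⟪Gr t i z, u - z⟫ ≤ r t i u
  hGgsub : ∀ t i, ∀ z ∈ X i, ∀ (j : Fin m), ∀ u ∈ X i,
    g t i z j + ⟪Gg t i z j, u - z⟫ ≤ g t i u j
  hGfbound : ∀ t i, ∀ z ∈ X i, ‖Gf t i z‖ ≤ G
  hGrbound : ∀ t i, ∀ z ∈ X i, ‖Gr t i z‖ ≤ G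
  hGgbound : ∀ t i, ∀ z ∈ X i, ∀ v, ‖vecOf (fun j => ⟪Gg t i z j, v⟫)‖ ≤ G * ‖v‖
  W : ℕ → Matrix (Fin n) (Fin n) ℝ
  hWnonneg : ∀ t i j, 0 ≤ W t i j
  hWrow : ∀ t i, ∑ j, W t i j = 1
  hWcol : ∀ t j, ∑ i, W t i j = 1
  w : ℝ
  hw0 : 0 < w
  hw1 : w < 1
  hWdiag : ∀ t i, w ≤ W t i i
  hWpos : ∀ t i j, 0 < W t i j → w ≤ W t i j
  iota : ℕ
  hiota : 0 < iota
  hconn : ∀ (t : ℕ) (c d : Fin n),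
    Relation.ReflTransGen (fun u v : Fin n => ∃ l < iota, 0 < W (t + l) v u) c d
  ψ : ∀ i : Fin n, EuclideanSpace ℝ (Fin (p i)) → ℝ
  ψ' : ∀ i : Fin n, EuclideanSpace ℝ (Fin (p i)) → EuclideanSpace ℝ (Fin (p i))
  hψgrad : ∀ i z, HasGradientAt (ψ i) (ψ' i z) z
  σ : Fin n → ℝ
  hσ : ∀ i, 0 < σ i
  hψstrong : ∀ i, ∀ z ∈ X i, ∀ u ∈ X i,
    ψ i u + ⟪ψ' i u, z - u⟫ + σ i / 2 * ‖z - u‖ ^ 2 ≤ ψ i z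
  K : ℝ
  hK : 0 < K
  hbregLip : ∀ i, ∀ z₁ ∈ X i, ∀ z₂ ∈ X i, ∀ u ∈ X i,
    |breg (ψ i) (ψ' i) z₁ u - breg (ψ i) (ψ' i) z₂ u| ≤ K * ‖z₁ - z₂‖
  Φ : ℕ → ∀ i : Fin n, EuclideanSpace ℝ (Fin (p i)) → EuclideanSpace ℝ (Fin (p i))
  hΦmaps : ∀ t i, ∀ z ∈ X i, Φ t i z ∈ X i
  hΦcontract : ∀ t i, ∀ z ∈ X i, ∀ u ∈ X i,
    breg (ψ i) (ψ' i) (Φ t i z) (Φ t i u) ≤ breg (ψ i) (ψ' i) z u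
  α : ℕ → ℝ
  β : ℕ → ℝ
  γ : ℕ → ℝ
  hαpos : ∀ t, 1 ≤ t → 0 < α t
  hβpos : ∀ t, 1 ≤ t → 0 < β t
  hγpos : ∀ t, 1 ≤ t → 0 < γ t
  hαanti : ∀ s t, 1 ≤ s → s ≤ t → α t ≤ α s
  hβanti : ∀ s t, 1 ≤ s → s ≤ t → β t ≤ β s
  hγanti : ∀ s t, 1 ≤ s → s ≤ t → γ t ≤ γ s
  x : ℕ → ∀ i : Fin n, EuclideanSpace ℝ (Fin (p i))
  xtil : ℕ → ∀ i : Fin n, EuclideanSpace ℝ (Fin (p i))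
  q : ℕ → Fin n → EuclideanSpace ℝ (Fin m)
  qtil : ℕ → Fin n → EuclideanSpace ℝ (Fin m)
  a : ℕ → ∀ i : Fin n, EuclideanSpace ℝ (Fin (p i))
  b : ℕ → Fin n → EuclideanSpace ℝ (Fin m)
  hx0 : ∀ i, x 0 i ∈ X i
  hq0 : ∀ i, q 0 i = 0
  hqtil : ∀ t, 1 ≤ t → ∀ i, qtil t i = ∑ j, W (t - 1) i j • q (t - 1) j
  ha : ∀ t, 1 ≤ t → ∀ i,
    a t i = Gf (t - 1) i (x (t - 1) i) + ∑ j, qtil t i j • Gg (t - 1) i (x (t - 1) i) j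
  hxtilmem : ∀ t, 1 ≤ t → ∀ i, xtil t i ∈ X i
  hxtilmin : ∀ t, 1 ≤ t → ∀ i, ∀ z ∈ X i,
    α t * ⟪xtil t i, a t i⟫ + α t * r (t - 1) i (xtil t i)
        + breg (ψ i) (ψ' i) (xtil t i) (x (t - 1) i)
      ≤ α t * ⟪z, a t i⟫ + α t * r (t - 1) i z + breg (ψ i) (ψ' i) z (x (t - 1) i)
  hb : ∀ t, 1 ≤ t → ∀ i,
    b t i = vecOf (fun j => ⟪Gg (t - 1) i (x (t - 1) i) j, xtil t i - x (t - 1) i⟫)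
      + g (t - 1) i (x (t - 1) i)
  hq : ∀ t, 1 ≤ t → ∀ i,
    q t i = posPart (qtil t i + γ t • (b t i - β t • qtil t i))
  hx : ∀ t, 1 ≤ t → ∀ i, x t i = Φ t i (xtil t i)

namespace Alg

variable {n m : ℕ} {p : Fin n → ℕ}

/-- Average dual variable `q̄_t`. -/
def qbar (S : Alg n m p) (t : ℕ) : EuclideanSpace ℝ (Fin m) :=
  (n : ℝ)⁻¹ • ∑ i, S.q t i

/-- `σ̲ = min_i σ_i`. -/
def sigmin (S : Alg n m p) : ℝ :=
  Finset.univ.inf' (Finset.univ_nonempty_iff.mpr ⟨⟨0, S.hn⟩⟩) S.σ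

/-- `τ = (1 − w/(2n²))⁻²`. -/
def tau (S : Alg n m p) : ℝ := ((1 - S.w / (2 * (n : ℝ) ^ 2)) ^ 2)⁻¹

/-- `λ = (1 − w/(2n²))^{1/ι}`. -/
def lam (S : Alg n m p) : ℝ := (1 - S.w / (2 * (n : ℝ) ^ 2)) ^ ((S.iota : ℝ))⁻¹

/-- `B₁ = 2F + G d(X)`. -/
def B1 (S : Alg n m p) : ℝ := 2 * S.F + S.G * S.dX

/-- `E₁(t) = n²τB₁F Σ_{s=1}^{t−1} γ_{s+1} λ^{t−1−s}`. -/
def E1 (S : Alg n m p) (t : ℕ) : ℝ :=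
  (n : ℝ) ^ 2 * S.tau * S.B1 * S.F *
    ∑ s ∈ Finset.Icc 1 (t - 1), S.γ (s + 1) * S.lam ^ (t - 1 - s)

/-- Global objective `f_t(y) = Σ_i (f_{i,t}(y_i) + r_{i,t}(y_i))`. -/
def fsum (S : Alg n m p) (t : ℕ) (y : ∀ i, EuclideanSpace ℝ (Fin (p i))) : ℝ :=
  ∑ i, (S.f t i (y i) + S.r t i (y i))

/-- Global constraint `g_t(y) = Σ_i g_{i,t}(y_i)`. -/
def gsum (S : Alg n m p) (t : ℕ) (y : ∀ i, EuclideanSpace ℝ (Fin (p i))) :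
    EuclideanSpace ℝ (Fin m) :=
  ∑ i, S.g t i (y i)

/-- Regret against a comparator sequence. -/
def reg (S : Alg n m p) (T : ℕ) (y : ℕ → ∀ i, EuclideanSpace ℝ (Fin (p i))) : ℝ :=
  ∑ t ∈ Finset.Icc 1 T, S.fsum t (S.x t) - ∑ t ∈ Finset.Icc 1 T, S.fsum t (y t)

/-- Feasibility of a comparator sequence on `1..T`. -/
def Feasible (S : Alg n m p) (T : ℕ) (y : ℕ → ∀ i, EuclideanSpace ℝ (Fin (p i))) : Prop :=
  ∀ t ∈ Finset.Icc 1 T, (∀ i, y t i ∈ S.X i) ∧ ∀ j, S.gsum t (y t) j ≤ 0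

/-- Accumulated dynamic variation `V_Φ(y_T)`. -/
def VPhi (S : Alg n m p) (T : ℕ) (y : ℕ → ∀ i, EuclideanSpace ℝ (Fin (p i))) : ℝ :=
  ∑ t ∈ Finset.Icc 1 (T - 1), ∑ i, ‖y (t + 1) i - S.Φ (t + 1) i (y t i)‖

/-- `E₂(t)` for a comparator sequence. -/
def E2 (S : Alg n m p) (y : ℕ → ∀ i, EuclideanSpace ℝ (Fin (p i))) (t : ℕ) : ℝ :=
  (S.α t)⁻¹ * ∑ i, (breg (S.ψ i) (S.ψ' i) (y (t - 1) i) (S.x (t - 1) i)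
    - breg (S.ψ i) (S.ψ' i) (y t i) (S.x t i))

/-- `C_{1,1} = 3n²τB₁F/(1−λ) + nB₁²/2`. -/
def C11 (S : Alg n m p) : ℝ :=
  3 * (n : ℝ) ^ 2 * S.tau * S.B1 * S.F / (1 - S.lam) + (n : ℝ) * S.B1 ^ 2 / 2

/-- `C_{1,2} = 4nG²/σ̲`. -/
def C12 (S : Alg n m p) : ℝ := 4 * (n : ℝ) * S.G ^ 2 / S.sigmin

/-- Constraint violation `‖[Σ_{t=1}^T g_t(x_t)]₊‖`. -/
def violation (S : Alg n m p) (T : ℕ) : ℝ :=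
  ‖posPart (∑ t ∈ Finset.Icc 1 T, S.gsum t (S.x t))‖

end Alg

/-! ### Consensus for products of doubly stochastic matrices -/

section Consensus

variable {n m : ℕ}

/-- Apply a mixing matrix to a family of vectors. -/
def mix (A : Matrix (Fin n) (Fin n) ℝ) (y : Fin n → EuclideanSpace ℝ (Fin m)) :
    Fin n → EuclideanSpace ℝ (Fin m) :=
  fun i => ∑ j, A i j • y j

/-- Subtract the average from a family of vectors. -/
def center (y : Fin n → EuclideanSpace ℝ (Fin m)) : Fin n → EuclideanSpace ℝ (Fin m) :=
  fun i => y i - (n : ℝ)⁻¹ • ∑ j, y j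

/-- The Euclidean norm of a family of vectors. -/
def l2 (y : Fin n → EuclideanSpace ℝ (Fin m)) : ℝ :=
  ‖(WithLp.toLp 2 y : PiLp 2 fun _ : Fin n => EuclideanSpace ℝ (Fin m))‖

lemma sq_sum_sub_sq_mean {a z : Fin n → ℝ} (ha : ∑ j, a j = 1) :
    ∑ j, a j * (z j - ∑ l, a l * z l) ^ 2 = ∑ j, a j * z j ^ 2 - (∑ l, a l * z l) ^ 2 := by
  set c := ∑ l, a l * z l with hc
  have h : ∀ j, a j * (z j - c) ^ 2 = a j * z j ^ 2 - 2 * c * (a j * z j) + c ^ 2 * a j := by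
    intro j; ring
  simp only [h, Finset.sum_add_distrib, Finset.sum_sub_distrib, ← Finset.mul_sum, ha, ← hc]
  ring

lemma sum_sq_mix_eq {A : Matrix (Fin n) (Fin n) ℝ} (hrow : ∀ i, ∑ j, A i j = 1)
    (hcol : ∀ j, ∑ i, A i j = 1) (z : Fin n → ℝ) :
    ∑ i, (∑ j, A i j * z j) ^ 2
      = ∑ j, z j ^ 2 - ∑ i, ∑ j, A i j * (z j - ∑ l, A i l * z l) ^ 2 := by
  simp only [fun i => sq_sum_sub_sq_mean (z := z) (hrow i), Finset.sum_sub_distrib]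
  rw [Finset.sum_comm (f := fun i j => A i j * z j ^ 2)]
  simp [← Finset.sum_mul, hcol]

lemma sum_sq_mix_le {A : Matrix (Fin n) (Fin n) ℝ} (hA : ∀ i j, 0 ≤ A i j)
    (hrow : ∀ i, ∑ j, A i j = 1) (hcol : ∀ j, ∑ i, A i j = 1) (z : Fin n → ℝ) :
    ∑ i, (∑ j, A i j * z j) ^ 2 ≤ ∑ j, z j ^ 2 := by
  rw [sum_sq_mix_eq hrow hcol]
  have : 0 ≤ ∑ i, ∑ j, A i j * (z j - ∑ l, A i l * z l) ^ 2 :=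
    Finset.sum_nonneg fun i _ => Finset.sum_nonneg fun j _ => mul_nonneg (hA i j) (sq_nonneg _)
  linarith

/-- One mixing step across a gap of width `h` decreases the energy by at least `w h² / 2`. -/
lemma sum_sq_mix_le_of_gap {A : Matrix (Fin n) (Fin n) ℝ} (hA : ∀ i j, 0 ≤ A i j)
    (hrow : ∀ i, ∑ j, A i j = 1) (hcol : ∀ j, ∑ i, A i j = 1) {w h : ℝ} (hw : 0 ≤ w)
    {z : Fin n → ℝ} {u v : Fin n} (huv : u ≠ v) (hv : w ≤ A v v) (hvu : w ≤ A v u)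
    (hgap : h ^ 2 ≤ (z u - z v) ^ 2) :
    ∑ i, (∑ j, A i j * z j) ^ 2 ≤ ∑ j, z j ^ 2 - w * h ^ 2 / 2 := by
  rw [sum_sq_mix_eq hrow hcol]
  set c := ∑ l, A v l * z l with hc
  have h1 : ∑ j, A v j * (z j - c) ^ 2 ≤ ∑ i, ∑ j, A i j * (z j - ∑ l, A i l * z l) ^ 2 :=
    Finset.single_le_sum (f := fun i => ∑ j, A i j * (z j - ∑ l, A i l * z l) ^ 2)
      (fun i _ => Finset.sum_nonneg fun j _ => mul_nonneg (hA i j) (sq_nonneg _))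
      (Finset.mem_univ v)
  have h2 : ∑ j ∈ {u, v}, A v j * (z j - c) ^ 2 ≤ ∑ j, A v j * (z j - c) ^ 2 :=
    Finset.sum_le_sum_of_subset_of_nonneg (Finset.subset_univ _)
      fun j _ _ => mul_nonneg (hA v j) (sq_nonneg _)
  rw [Finset.sum_pair huv] at h2
  have h3 := mul_le_mul_of_nonneg_right hvu (sq_nonneg (z u - c))
  have h4 := mul_le_mul_of_nonneg_right hv (sq_nonneg (z v - c))
  have h5 : h ^ 2 / 2 ≤ (z u - c) ^ 2 + (z v - c) ^ 2 := by
    nlinarith [sq_nonneg ((z u - c) + (z v - c))]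
  have h6 := mul_le_mul_of_nonneg_left h5 hw
  nlinarith

/-- Among `n` reals spread over length `L`, some gap has width at least `L / n`. -/
lemma exists_gap {z : Fin n → ℝ} {a b : Fin n} (hab : z a < z b) :
    ∃ θ, z a ≤ θ ∧ θ + (z b - z a) / n ≤ z b ∧
      ∀ i, z i ≤ θ ∨ θ + (z b - z a) / n ≤ z i := by
  have hn : (0 : ℝ) < n := by exact_mod_cast a.pos
  set h := (z b - z a) / n with hh
  have hpos : 0 < h := div_pos (sub_pos.2 hab) hn
  have hnh : z b = z a + n * h := by rw [hh]; field_simp; ring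
  by_contra! hcon
  have key : ∀ k : Fin n, ∃ i, z a + (k : ℕ) * h < z i ∧ z i < z a + (k : ℕ) * h + h := by
    intro k
    refine hcon _ (by nlinarith [(k : ℕ).cast_nonneg (α := ℝ)]) ?_
    have : ((k : ℕ) : ℝ) + 1 ≤ n := by exact_mod_cast k.isLt
    nlinarith
  choose φ hφ using key
  have hinj : Function.Injective φ := by
    intro k l hkl
    have hk := hφ k
    have hl := hφ l
    rw [hkl] at hk
    have h1 : ((k : ℕ) : ℝ) < (l : ℕ) + 1 := by nlinarith [hk.1, hl.2]
    have h2 : ((l : ℕ) : ℝ) < (k : ℕ) + 1 := by nlinarith [hk.2, hl.1]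
    norm_cast at h1 h2
    exact Fin.ext (by omega)
  obtain ⟨k, hk⟩ := Finite.surjective_of_injective hinj a
  have := (hφ k).1
  rw [hk] at this
  nlinarith [(k : ℕ).cast_nonneg (α := ℝ)]

lemma exists_crossing {R : Fin n → Fin n → Prop} {s : Set (Fin n)} {c d : Fin n}
    (hcd : Relation.ReflTransGen R c d) (hc : c ∈ s) (hd : d ∉ s) :
    ∃ u v, u ∈ s ∧ v ∉ s ∧ R u v := by
  induction hcd with
  | refl => exact absurd hc hd
  | @tail e f _ hef ih =>
    by_cases he : e ∈ s
    · exact ⟨e, f, he, hd, hef⟩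
    · exact ih he

variable {A : ℕ → Matrix (Fin n) (Fin n) ℝ} {w : ℝ} {N : ℕ}

lemma sum_sq_antitone (hA : ∀ k i j, 0 ≤ A k i j)
    (hrow : ∀ k i, ∑ j, A k i j = 1) (hcol : ∀ k j, ∑ i, A k i j = 1) {z : ℕ → Fin n → ℝ}
    (hz : ∀ k i, z (k + 1) i = ∑ j, A k i j * z k j) :
    Antitone fun k => ∑ i, z k i ^ 2 :=
  antitone_nat_of_succ_le fun k => by
    simp only [hz]
    exact sum_sq_mix_le (hA k) (hrow k) (hcol k) _

/-- Over a connected window the energy drops by at least `w (z b - z a)² / (2 n²)`. -/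
lemma sum_sq_window_le (hA : ∀ k i j, 0 ≤ A k i j)
    (hrow : ∀ k i, ∑ j, A k i j = 1) (hcol : ∀ k j, ∑ i, A k i j = 1) (hw : 0 ≤ w)
    (hdiag : ∀ k i, w ≤ A k i i) (hpos : ∀ k i j, 0 < A k i j → w ≤ A k i j)
    (hconn : ∀ c d : Fin n,
      Relation.ReflTransGen (fun u v : Fin n => ∃ l < N, 0 < A l v u) c d)
    {z : ℕ → Fin n → ℝ} (hz : ∀ k i, z (k + 1) i = ∑ j, A k i j * z k j) {a b : Fin n}
    (hab : z 0 a < z 0 b) :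
    ∑ i, z N i ^ 2 ≤ ∑ i, z 0 i ^ 2 - w * ((z 0 b - z 0 a) / n) ^ 2 / 2 := by
  classical
  obtain ⟨θ, hθa, hθb, hθ⟩ := exists_gap hab
  set h := (z 0 b - z 0 a) / n with hh
  have hn : (0 : ℝ) < n := by exact_mod_cast a.pos
  have hhpos : 0 < h := div_pos (sub_pos.2 hab) hn
  let P : ℕ → Prop := fun l => l < N ∧ ∃ u v, ¬ (z 0 u ≤ θ ↔ z 0 v ≤ θ) ∧ 0 < A l v u
  have hex : ∃ l, P l := by
    obtain ⟨u, v, hu, hv, l, hl, hlA⟩ :=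
      exists_crossing (s := {i | z 0 i ≤ θ}) (hconn a b) hθa (by simp; linarith)
    exact ⟨l, hl, u, v, by simp_all, hlA⟩
  set k := Nat.find hex with hk
  obtain ⟨hkN, u, v, huv, hA0⟩ := Nat.find_spec hex
  rw [← hk] at hkN hA0
  have hsep : ∀ l ≤ k, ∀ i, (z 0 i ≤ θ → z l i ≤ θ) ∧ (¬ z 0 i ≤ θ → θ + h ≤ z l i) := by
    intro l
    induction l with
    | zero =>
      intro _ i
      exact ⟨id, fun hi => (hθ i).resolve_left hi⟩
    | succ l ih =>
      intro hl i
      have hzero : ∀ j, ¬ (z 0 j ≤ θ ↔ z 0 i ≤ θ) → A l i j = 0 := by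
        intro j hj
        by_contra hne
        exact Nat.find_min hex (m := l) (by omega)
          ⟨by omega, j, i, hj, lt_of_le_of_ne (hA l i j) (Ne.symm hne)⟩
      rw [hz]
      constructor
      · intro hi
        calc ∑ j, A l i j * z l j ≤ ∑ j, A l i j * θ := by
              refine Finset.sum_le_sum fun j _ => ?_
              by_cases hj : z 0 j ≤ θ
              · exact mul_le_mul_of_nonneg_left ((ih (by omega) j).1 hj) (hA l i j)
              · rw [hzero j (by tauto)]; simp
          _ = θ := by rw [← Finset.sum_mul, hrow, one_mul]
      · intro hi
        calc θ + h = ∑ j, A l i j * (θ + h) := by rw [← Finset.sum_mul, hrow, one_mul]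
          _ ≤ ∑ j, A l i j * z l j := by
              refine Finset.sum_le_sum fun j _ => ?_
              by_cases hj : z 0 j ≤ θ
              · rw [hzero j (by tauto)]; simp
              · exact mul_le_mul_of_nonneg_left ((ih (by omega) j).2 hj) (hA l i j)
  have hgap : h ^ 2 ≤ (z k u - z k v) ^ 2 := by
    by_cases hu : z 0 u ≤ θ
    · have h1 := (hsep k le_rfl u).1 hu
      have h2 := (hsep k le_rfl v).2 (by tauto)
      nlinarith
    · have h1 := (hsep k le_rfl u).2 hu
      have h2 := (hsep k le_rfl v).1 (by tauto)
      nlinarith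
  have hne : u ≠ v := by rintro rfl; simp at huv
  have hmono := sum_sq_antitone hA hrow hcol hz
  have hstep := sum_sq_mix_le_of_gap (hA k) (hrow k) (hcol k) hw hne (hdiag k v)
    (hpos k v u hA0) hgap
  simp only [← hz] at hstep
  have h1 := hmono (Nat.succ_le_of_lt hkN)
  have h2 := hmono (Nat.zero_le k)
  simp only [Nat.succ_eq_add_one] at h1 h2
  linarith

/-- Contraction of mean-zero scalars over a connected window. -/
lemma sum_sq_window_contract (hA : ∀ k i j, 0 ≤ A k i j)
    (hrow : ∀ k i, ∑ j, A k i j = 1) (hcol : ∀ k j, ∑ i, A k i j = 1) (hw : 0 ≤ w)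
    (hdiag : ∀ k i, w ≤ A k i i) (hpos : ∀ k i j, 0 < A k i j → w ≤ A k i j)
    (hconn : ∀ c d : Fin n,
      Relation.ReflTransGen (fun u v : Fin n => ∃ l < N, 0 < A l v u) c d)
    {z : ℕ → Fin n → ℝ} (hz : ∀ k i, z (k + 1) i = ∑ j, A k i j * z k j)
    (hn : 0 < n) (h0 : ∑ i, z 0 i = 0) :
    ∑ i, z N i ^ 2 ≤ (1 - w / (2 * (n : ℝ) ^ 3)) * ∑ i, z 0 i ^ 2 := by
  have : Nonempty (Fin n) := ⟨⟨0, hn⟩⟩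
  obtain ⟨b, hb⟩ := Finite.exists_max (z 0)
  obtain ⟨a, ha⟩ := Finite.exists_min (z 0)
  have hn' : (0 : ℝ) < n := by exact_mod_cast hn
  have hb0 : 0 ≤ z 0 b := by
    by_contra! hlt
    have : ∑ i, z 0 i < 0 :=
      Finset.sum_neg (fun i _ => (hb i).trans_lt hlt) Finset.univ_nonempty
    linarith
  have ha0 : z 0 a ≤ 0 := by
    by_contra! hlt
    have : 0 < ∑ i, z 0 i :=
      Finset.sum_pos (fun i _ => hlt.trans_le (ha i)) Finset.univ_nonempty
    linarith
  have hE : ∑ i, z 0 i ^ 2 ≤ n * (z 0 b - z 0 a) ^ 2 := by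
    calc ∑ i, z 0 i ^ 2 ≤ ∑ _i : Fin n, (z 0 b - z 0 a) ^ 2 :=
          Finset.sum_le_sum fun i _ => by nlinarith [ha i, hb i]
      _ = n * (z 0 b - z 0 a) ^ 2 := by simp
  rcases (ha b).lt_or_eq with hlt | heq
  · have h1 := sum_sq_window_le hA hrow hcol hw hdiag hpos hconn hz hlt
    have h2 : w / (2 * (n : ℝ) ^ 3) * ∑ i, z 0 i ^ 2
        ≤ w * ((z 0 b - z 0 a) / n) ^ 2 / 2 := by
      calc w / (2 * (n : ℝ) ^ 3) * ∑ i, z 0 i ^ 2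
          ≤ w / (2 * (n : ℝ) ^ 3) * (n * (z 0 b - z 0 a) ^ 2) := by gcongr
        _ = w * ((z 0 b - z 0 a) / n) ^ 2 / 2 := by field_simp
    linarith
  · have h1 := sum_sq_antitone hA hrow hcol hz (Nat.zero_le N)
    have h2 : ∑ i, z 0 i ^ 2 = 0 :=
      le_antisymm (by simpa [heq] using hE) (Finset.sum_nonneg fun i _ => sq_nonneg _)
    simp only at h1
    rw [h2] at h1 ⊢
    linarith

lemma l2_nonneg (y : Fin n → EuclideanSpace ℝ (Fin m)) : 0 ≤ l2 y := norm_nonneg _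

lemma l2_sq (y : Fin n → EuclideanSpace ℝ (Fin m)) : l2 y ^ 2 = ∑ i, ‖y i‖ ^ 2 :=
  PiLp.norm_sq_eq_of_L2 _ _

lemma l2_sq_coord (y : Fin n → EuclideanSpace ℝ (Fin m)) :
    l2 y ^ 2 = ∑ c, ∑ i, y i c ^ 2 := by
  rw [l2_sq, Finset.sum_comm]
  exact Finset.sum_congr rfl fun i _ => EuclideanSpace.real_norm_sq_eq _

lemma l2_add_le (y z : Fin n → EuclideanSpace ℝ (Fin m)) : l2 (y + z) ≤ l2 y + l2 z := by
  unfold l2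
  rw [WithLp.toLp_add]
  exact norm_add_le _ _

lemma sum_norm_le_l2 (y : Fin n → EuclideanSpace ℝ (Fin m)) :
    ∑ i, ‖y i‖ ≤ √n * l2 y := by
  have h := sq_sum_le_card_mul_sum_sq (s := Finset.univ) (f := fun i => ‖y i‖)
  rw [← l2_sq, Finset.card_univ, Fintype.card_fin] at h
  refine abs_le_of_sq_le_sq' ?_ (mul_nonneg (Real.sqrt_nonneg _) (l2_nonneg y)) |>.2
  rw [mul_pow, Real.sq_sqrt (Nat.cast_nonneg n)]
  exact h

lemma l2_le_of_norm_le {y : Fin n → EuclideanSpace ℝ (Fin m)} {B : ℝ} (hB : 0 ≤ B)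
    (hy : ∀ i, ‖y i‖ ≤ B) : l2 y ≤ √n * B := by
  refine abs_le_of_sq_le_sq' ?_ (by positivity) |>.2
  rw [mul_pow, Real.sq_sqrt (Nat.cast_nonneg n), l2_sq]
  calc ∑ i, ‖y i‖ ^ 2 ≤ ∑ _i : Fin n, B ^ 2 :=
        Finset.sum_le_sum fun i _ => pow_le_pow_left₀ (norm_nonneg _) (hy i) 2
    _ = n * B ^ 2 := by simp

lemma mix_apply_coord (B : Matrix (Fin n) (Fin n) ℝ) (y : Fin n → EuclideanSpace ℝ (Fin m))
    (i : Fin n) (c : Fin m) : mix B y i c = ∑ j, B i j * y j c := by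
  simp [mix]

lemma l2_mix_le {B : Matrix (Fin n) (Fin n) ℝ} (hB : ∀ i j, 0 ≤ B i j)
    (hrow : ∀ i, ∑ j, B i j = 1) (hcol : ∀ j, ∑ i, B i j = 1)
    (y : Fin n → EuclideanSpace ℝ (Fin m)) : l2 (mix B y) ≤ l2 y := by
  refine abs_le_of_sq_le_sq' ?_ (l2_nonneg y) |>.2
  rw [l2_sq_coord, l2_sq_coord]
  refine Finset.sum_le_sum fun c _ => ?_
  simp only [mix_apply_coord]
  exact sum_sq_mix_le hB hrow hcol _

lemma mix_sub (B : Matrix (Fin n) (Fin n) ℝ) (y z : Fin n → EuclideanSpace ℝ (Fin m)) :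
    mix B (y - z) = mix B y - mix B z := by
  ext1 i
  simp [mix, smul_sub]

lemma sum_mix {B : Matrix (Fin n) (Fin n) ℝ} (hcol : ∀ j, ∑ i, B i j = 1)
    (y : Fin n → EuclideanSpace ℝ (Fin m)) : ∑ i, mix B y i = ∑ i, y i := by
  simp only [mix]
  rw [Finset.sum_comm]
  simp [← Finset.sum_smul, hcol]

lemma center_sub (y z : Fin n → EuclideanSpace ℝ (Fin m)) :
    center (y - z) = center y - center z := by
  ext1 i
  simp only [center, Pi.sub_apply, Finset.sum_sub_distrib, smul_sub]
  abel

lemma center_mix {B : Matrix (Fin n) (Fin n) ℝ} (hrow : ∀ i, ∑ j, B i j = 1)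
    (hcol : ∀ j, ∑ i, B i j = 1) (y : Fin n → EuclideanSpace ℝ (Fin m)) :
    center (mix B y) = mix B (center y) := by
  ext1 i
  have h := sum_mix hcol y
  simp only [mix] at h
  simp only [center, mix, h, smul_sub, Finset.sum_sub_distrib, ← Finset.sum_smul, hrow, one_smul]

lemma sum_center (hn : 0 < n) (y : Fin n → EuclideanSpace ℝ (Fin m)) :
    ∑ i, center y i = 0 := by
  have hn' : (n : ℝ) ≠ 0 := by exact_mod_cast hn.ne'
  simp only [center, Finset.sum_sub_distrib, Finset.sum_const, Finset.card_univ,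
    Fintype.card_fin, ← Nat.cast_smul_eq_nsmul ℝ, smul_smul]
  rw [mul_inv_cancel₀ hn', one_smul, sub_self]

lemma l2_center_le (hn : 0 < n) (y : Fin n → EuclideanSpace ℝ (Fin m)) :
    l2 (center y) ≤ l2 y := by
  refine abs_le_of_sq_le_sq' ?_ (l2_nonneg y) |>.2
  have h0 := sum_center hn y
  set c := (n : ℝ)⁻¹ • ∑ j, y j with hc
  have hy : ∀ i, y i = center y i + c := fun i => by simp [center, hc]
  have h1 : ∀ i, ‖y i‖ ^ 2 = ‖center y i‖ ^ 2 + 2 * ⟪center y i, c⟫ + ‖c‖ ^ 2 := fun i => by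
    conv_lhs => rw [hy i]
    exact norm_add_sq_real _ _
  rw [l2_sq, l2_sq]
  simp only [h1, Finset.sum_add_distrib, ← Finset.mul_sum, ← sum_inner, h0, inner_zero_left]
  have : 0 ≤ ∑ _i : Fin n, ‖c‖ ^ 2 := Finset.sum_nonneg fun _ _ => sq_nonneg _
  linarith

/-- Contraction of mean-zero vectors over a connected window. -/
lemma l2_window_contract (hA : ∀ k i j, 0 ≤ A k i j)
    (hrow : ∀ k i, ∑ j, A k i j = 1) (hcol : ∀ k j, ∑ i, A k i j = 1) (hw : 0 ≤ w) (hw1 : w ≤ 1)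
    (hdiag : ∀ k i, w ≤ A k i i) (hpos : ∀ k i j, 0 < A k i j → w ≤ A k i j)
    (hconn : ∀ c d : Fin n,
      Relation.ReflTransGen (fun u v : Fin n => ∃ l < N, 0 < A l v u) c d)
    {y : ℕ → Fin n → EuclideanSpace ℝ (Fin m)} (hy : ∀ k, y (k + 1) = mix (A k) (y k))
    (hn : 0 < n) (h0 : ∑ i, y 0 i = 0) :
    l2 (y N) ≤ (1 - w / (4 * (n : ℝ) ^ 3)) * l2 (y 0) := by
  have hn' : (1 : ℝ) ≤ n := by exact_mod_cast hn
  have hn3 : (1 : ℝ) ≤ (n : ℝ) ^ 3 := one_le_pow₀ hn'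
  have hw4 : w / (4 * (n : ℝ) ^ 3) ≤ 1 := (div_le_one (by positivity)).2 (by linarith)
  refine abs_le_of_sq_le_sq' ?_ (mul_nonneg (by linarith) (l2_nonneg _)) |>.2
  have h1 : l2 (y N) ^ 2 ≤ (1 - w / (2 * (n : ℝ) ^ 3)) * l2 (y 0) ^ 2 := by
    rw [l2_sq_coord, l2_sq_coord, Finset.mul_sum]
    refine Finset.sum_le_sum fun c _ => ?_
    refine sum_sq_window_contract (z := fun k i => y k i c) hA hrow hcol hw hdiag hpos hconn
      (fun k i => by rw [hy, mix_apply_coord]) hn ?_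
    simpa using congrArg (fun v : EuclideanSpace ℝ (Fin m) => v c) h0
  have h2 : 1 - w / (2 * (n : ℝ) ^ 3) ≤ (1 - w / (4 * (n : ℝ) ^ 3)) ^ 2 := by
    have : w / (2 * (n : ℝ) ^ 3) = 2 * (w / (4 * (n : ℝ) ^ 3)) := by field_simp; ring
    rw [this]
    nlinarith [sq_nonneg (w / (4 * (n : ℝ) ^ 3))]
  rw [mul_pow]
  exact h1.trans (mul_le_mul_of_nonneg_right h2 (sq_nonneg _))

/-- Uniform disagreement bound for consensus with bounded perturbations. -/
lemma l2_center_le_of_perturbed (hA : ∀ k i j, 0 ≤ A k i j)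
    (hrow : ∀ k i, ∑ j, A k i j = 1) (hcol : ∀ k j, ∑ i, A k i j = 1) (hw : 0 < w) (hw1 : w ≤ 1)
    (hdiag : ∀ k i, w ≤ A k i i) (hpos : ∀ k i j, 0 < A k i j → w ≤ A k i j) (hN : 0 < N)
    (hconn : ∀ (t : ℕ) (c d : Fin n),
      Relation.ReflTransGen (fun u v : Fin n => ∃ l < N, 0 < A (t + l) v u) c d)
    (hn : 0 < n) {Q : ℕ → Fin n → EuclideanSpace ℝ (Fin m)} {B : ℝ} (hB : 0 ≤ B)
    (hQ0 : Q 0 = 0) (hQ : ∀ t i, ‖Q (t + 1) i - mix (A t) (Q t) i‖ ≤ B) (t : ℕ) :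
    l2 (center (Q t)) ≤ 4 * (n : ℝ) ^ 3 * N * (√n * B) / w := by
  set D := √n * B with hD
  have hD0 : 0 ≤ D := by positivity
  have hstep : ∀ t, l2 (center (Q (t + 1)) - mix (A t) (center (Q t))) ≤ D := by
    intro t
    rw [← center_mix (hrow t) (hcol t), ← center_sub]
    exact (l2_center_le hn _).trans (l2_le_of_norm_le hB (hQ t))
  let y : ℕ → ℕ → Fin n → EuclideanSpace ℝ (Fin m) := fun s k =>
    Nat.rec (center (Q s)) (fun k v => mix (A (s + k)) v) k
  have hy : ∀ s k, y s (k + 1) = mix (A (s + k)) (y s k) := fun s k => rfl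
  have hdist : ∀ s k, l2 (center (Q (s + k)) - y s k) ≤ k * D := by
    intro s k
    induction k with
    | zero => simp [y, l2]
    | succ k ih =>
      have h1 : center (Q (s + (k + 1))) - y s (k + 1)
          = (center (Q (s + k + 1)) - mix (A (s + k)) (center (Q (s + k))))
            + mix (A (s + k)) (center (Q (s + k)) - y s k) := by
        rw [hy, mix_sub, ← add_assoc s k 1]; abel
      rw [h1]
      calc _ ≤ _ := l2_add_le _ _
        _ ≤ D + k * D := add_le_add (hstep _) ((l2_mix_le (hA _) (hrow _) (hcol _) _).trans ih)
        _ = ((k + 1 : ℕ) : ℝ) * D := by push_cast; ring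
  have hn' : (1 : ℝ) ≤ n := by exact_mod_cast hn
  have hn3 : (1 : ℝ) ≤ (n : ℝ) ^ 3 := one_le_pow₀ hn'
  set M := 4 * (n : ℝ) ^ 3 * N * D / w with hM
  have hND : N * D ≤ M := by
    rw [hM, le_div_iff₀ hw]
    have : 0 ≤ N * D := by positivity
    nlinarith
  induction t using Nat.strong_induction_on with
  | _ t ih =>
    rcases lt_or_ge t N with hlt | hge
    · have h1 := hdist 0 t
      have h2 : ∀ k, y 0 k = 0 := by
        intro k
        induction k with
        | zero => ext1 i; simp [y, hQ0, center]
        | succ k ih => rw [hy, ih]; ext1 i; simp [mix]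
      rw [h2, sub_zero, zero_add] at h1
      refine h1.trans (le_trans ?_ hND)
      gcongr
    · obtain ⟨s, rfl⟩ := Nat.exists_eq_add_of_le' hge
      have h1 := hdist s N
      have h2 : l2 (y s N) ≤ (1 - w / (4 * (n : ℝ) ^ 3)) * l2 (center (Q s)) :=
        l2_window_contract (A := fun k => A (s + k)) (fun k => hA _) (fun k => hrow _)
          (fun k => hcol _) hw.le hw1 (fun k => hdiag _) (fun k => hpos _) (hconn s) (hy s) hn
          (sum_center hn _)
      have h3 := ih s (by omega)
      have hw4 : w / (4 * (n : ℝ) ^ 3) ≤ 1 := (div_le_one (by positivity)).2 (by linarith)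
      have h4 := mul_le_mul_of_nonneg_left h3 (sub_nonneg.2 hw4)
      have h5 : l2 (center (Q (s + N))) ≤ l2 (center (Q (s + N)) - y s N) + l2 (y s N) := by
        simpa using l2_add_le (center (Q (s + N)) - y s N) (y s N)
      have h6 : (1 - w / (4 * (n : ℝ) ^ 3)) * M = M - N * D := by
        rw [hM]; field_simp
      linarith

end Consensus

/-! ### Positive parts and coordinatewise estimates -/

section PosPart

variable {d : ℕ}

lemma posPart_apply (v : EuclideanSpace ℝ (Fin d)) (j : Fin d) : posPart v j = max (v j) 0 := rfl

lemma norm_le_norm_of_abs_le {u v : EuclideanSpace ℝ (Fin d)} (h : ∀ j, |u j| ≤ |v j|) :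
    ‖u‖ ≤ ‖v‖ := by
  refine abs_le_of_sq_le_sq' ?_ (norm_nonneg v) |>.2
  rw [EuclideanSpace.real_norm_sq_eq, EuclideanSpace.real_norm_sq_eq]
  exact Finset.sum_le_sum fun j _ => sq_le_sq.2 (h j)

lemma norm_posPart_sub_le {u v : EuclideanSpace ℝ (Fin d)} (hu : ∀ j, 0 ≤ u j) :
    ‖posPart v - u‖ ≤ ‖v - u‖ := by
  refine norm_le_norm_of_abs_le fun j => ?_
  simp only [PiLp.sub_apply, posPart_apply]
  have := abs_max_sub_max_le_abs (v j) (u j) 0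
  rwa [max_eq_left (hu j)] at this

lemma inner_eq_sum_mul (u v : EuclideanSpace ℝ (Fin d)) : ⟪u, v⟫ = ∑ j, u j * v j := by
  simp [PiLp.inner_apply, mul_comm]

lemma inner_posPart_self (v : EuclideanSpace ℝ (Fin d)) :
    ⟪posPart v, v⟫ = ‖posPart v‖ ^ 2 := by
  rw [inner_eq_sum_mul, EuclideanSpace.real_norm_sq_eq]
  refine Finset.sum_congr rfl fun j _ => ?_
  rw [posPart_apply]
  rcases le_total (v j) 0 with h | h
  · simp [max_eq_right h]
  · rw [max_eq_left h]; ring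

end PosPart

/-! ### Bregman divergences and the mirror descent step -/

section Bregman

variable {d : ℕ} {ψ : EuclideanSpace ℝ (Fin d) → ℝ}
  {ψ' : EuclideanSpace ℝ (Fin d) → EuclideanSpace ℝ (Fin d)}

lemma breg_self (y : EuclideanSpace ℝ (Fin d)) : breg ψ ψ' y y = 0 := by simp [breg]

lemma breg_three_point (x y z : EuclideanSpace ℝ (Fin d)) :
    breg ψ ψ' y x - breg ψ ψ' y z - breg ψ ψ' z x = ⟪ψ' z, y - z⟫ - ⟪ψ' x, y - z⟫ := by
  have : y - x = (y - z) + (z - x) := by abel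
  simp only [breg]
  rw [this, inner_add_right]
  ring

lemma mirror_step {X : Set (EuclideanSpace ℝ (Fin d))} (hX : Convex ℝ X)
    {r : EuclideanSpace ℝ (Fin d) → ℝ} (hr : ConvexOn ℝ X r) {α : ℝ} (hα : 0 ≤ α)
    {x z a : EuclideanSpace ℝ (Fin d)} (hψ : HasGradientAt ψ (ψ' z) z) (hz : z ∈ X)
    (hmin : ∀ u ∈ X, α * ⟪z, a⟫ + α * r z + breg ψ ψ' z x
      ≤ α * ⟪u, a⟫ + α * r u + breg ψ ψ' u x)
    {y : EuclideanSpace ℝ (Fin d)} (hy : y ∈ X) :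
    α * (⟪z - y, a⟫ + r z - r y) ≤ breg ψ ψ' y x - breg ψ ψ' y z - breg ψ ψ' z x := by
  rw [breg_three_point]
  have hline : HasDerivAt (fun s : ℝ => z + s • (y - z)) (y - z) 0 := by
    simpa using ((hasDerivAt_id (0 : ℝ)).smul_const (y - z)).const_add z
  have hder : HasDerivAt (fun s : ℝ => ψ (z + s • (y - z))) ⟪ψ' z, y - z⟫ 0 := by
    have h0 : z = z + (0 : ℝ) • (y - z) := by simp
    have h1 := hψ.hasFDerivAt
    rw [h0] at h1
    have h2 := h1.comp_hasDerivAt (0 : ℝ) hline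
    simpa [Function.comp_def] using h2
  have hlim := hder.tendsto_slope_zero_right
  have hev : ∀ᶠ s : ℝ in nhdsWithin 0 (Set.Ioi 0),
      ⟪ψ' x, y - z⟫ + α * (⟪z - y, a⟫ + r z - r y)
        ≤ s⁻¹ • (ψ (z + (0 + s) • (y - z)) - ψ (z + (0 : ℝ) • (y - z))) := by
    filter_upwards [Ioo_mem_nhdsGT (zero_lt_one (α := ℝ))] with s hs
    obtain ⟨hs0, hs1⟩ := hs
    have hcomb : z + s • (y - z) = (1 - s) • z + s • y := by module
    have hmem : z + s • (y - z) ∈ X := by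
      rw [hcomb]; exact hX hz hy (by linarith) hs0.le (by ring)
    have hrs : r (z + s • (y - z)) ≤ (1 - s) * r z + s * r y := by
      rw [hcomb]; exact hr.2 hz hy (by linarith) hs0.le (by ring)
    have hm := hmin _ hmem
    have hb : breg ψ ψ' (z + s • (y - z)) x - breg ψ ψ' z x
        = ψ (z + s • (y - z)) - ψ z - s * ⟪ψ' x, y - z⟫ := by
      have : z + s • (y - z) - x = (z - x) + s • (y - z) := by abel
      simp only [breg]
      rw [this, inner_add_right, real_inner_smul_right]
      ring
    have hi : ⟪z + s • (y - z), a⟫ = ⟪z, a⟫ - s * ⟪z - y, a⟫ := by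
      rw [inner_add_left, real_inner_smul_left, ← neg_sub z y, inner_neg_left]; ring
    have hr' := mul_le_mul_of_nonneg_left hrs hα
    rw [hi] at hm
    rw [zero_add, zero_smul, add_zero, smul_eq_mul, le_inv_mul_iff₀ hs0]
    nlinarith
  linarith [ge_of_tendsto hlim hev]

end Bregman

/-! ### Estimates for one step of Algorithm 1 -/

namespace Alg

variable {n m : ℕ} {p : Fin n → ℕ} (S : Alg n m p)

lemma xtil_eq_x (hΦid : ∀ t i (z : EuclideanSpace ℝ (Fin (p i))), S.Φ t i z = z)
    {t : ℕ} (ht : 1 ≤ t) (i : Fin n) : S.xtil t i = S.x t i := by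
  rw [S.hx t ht i, hΦid]

lemma x_mem (t : ℕ) (i : Fin n) : S.x t i ∈ S.X i := by
  rcases Nat.eq_zero_or_pos t with rfl | ht
  · exact S.hx0 i
  · rw [S.hx t ht i]
    exact S.hΦmaps t i _ (S.hxtilmem t ht i)

lemma norm_sub_le_dX {i : Fin n} {u v : EuclideanSpace ℝ (Fin (p i))} (hu : u ∈ S.X i)
    (hv : v ∈ S.X i) : ‖u - v‖ ≤ S.dX := by
  classical
  have hmem : ∀ z ∈ S.X i, ∀ k, stack (Function.update (S.x 0) i z) k ∈ S.X k := by
    intro z hz k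
    change Function.update (S.x 0) i z k ∈ S.X k
    by_cases h : k = i
    · subst h; simpa using hz
    · simpa [h] using S.hx0 k
  have h1 := S.hdiam _ _ (hmem u hu) (hmem v hv)
  have h2 := PiLp.norm_apply_le
    (stack (Function.update (S.x 0) i u) - stack (Function.update (S.x 0) i v)) i
  refine le_trans (le_of_eq ?_) (h2.trans h1)
  simp [stack]

lemma B1_pos : 0 < S.B1 := by
  have := S.hF
  have := S.hG
  have := S.hdX
  unfold B1
  positivity

lemma sigmin_le (i : Fin n) : S.sigmin ≤ S.σ i := Finset.inf'_le _ (Finset.mem_univ i)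

lemma sigmin_pos : 0 < S.sigmin := (Finset.lt_inf'_iff _).2 fun i _ => S.hσ i

lemma sigmin_mul_le_breg {i : Fin n} {u v : EuclideanSpace ℝ (Fin (p i))} (hu : u ∈ S.X i)
    (hv : v ∈ S.X i) : S.sigmin / 2 * ‖u - v‖ ^ 2 ≤ breg (S.ψ i) (S.ψ' i) u v := by
  have h1 := S.hψstrong i u hu v hv
  have h2 := mul_le_mul_of_nonneg_right (S.sigmin_le i) (sq_nonneg ‖u - v‖)
  unfold breg
  linarith

lemma breg_nonneg {i : Fin n} {u v : EuclideanSpace ℝ (Fin (p i))} (hu : u ∈ S.X i)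
    (hv : v ∈ S.X i) : 0 ≤ breg (S.ψ i) (S.ψ' i) u v :=
  (mul_nonneg (half_pos S.sigmin_pos).le (sq_nonneg _)).trans (S.sigmin_mul_le_breg hu hv)

lemma breg_le {i : Fin n} {u v : EuclideanSpace ℝ (Fin (p i))} (hu : u ∈ S.X i)
    (hv : v ∈ S.X i) : breg (S.ψ i) (S.ψ' i) u v ≤ S.K * S.dX := by
  have h := S.hbregLip i u hu v hv v hv
  rw [breg_self, sub_zero] at h
  exact (le_abs_self _).trans (h.trans (mul_le_mul_of_nonneg_left (S.norm_sub_le_dX hu hv) S.hK.le))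

lemma qtil_succ (t : ℕ) : S.qtil (t + 1) = mix (S.W t) (S.q t) := by
  ext1 i
  exact S.hqtil (t + 1) (by omega) i

lemma q_nonneg (t : ℕ) (i : Fin n) (j : Fin m) : 0 ≤ S.q t i j := by
  rcases Nat.eq_zero_or_pos t with rfl | ht
  · simp [S.hq0]
  · rw [S.hq t ht i, posPart_apply]
    exact le_max_right _ _

lemma qtil_nonneg (t : ℕ) (i : Fin n) (j : Fin m) : 0 ≤ S.qtil (t + 1) i j := by
  rw [qtil_succ, mix_apply_coord]
  exact Finset.sum_nonneg fun k _ => mul_nonneg (S.hWnonneg t i k) (S.q_nonneg t k j)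

lemma b_succ_apply (t : ℕ) (i : Fin n) (j : Fin m) :
    S.b (t + 1) i j = ⟪S.Gg t i (S.x t i) j, S.xtil (t + 1) i - S.x t i⟫ + S.g t i (S.x t i) j := by
  rw [S.hb (t + 1) (by omega) i]
  rfl

lemma b_succ_le (t : ℕ) (i : Fin n) (j : Fin m) :
    S.b (t + 1) i j ≤ S.g t i (S.xtil (t + 1) i) j := by
  rw [b_succ_apply]
  linarith [S.hGgsub t i _ (S.x_mem t i) j _ (S.hxtilmem (t + 1) (by omega) i)]

lemma norm_b_succ_le (t : ℕ) (i : Fin n) : ‖S.b (t + 1) i‖ ≤ S.F + S.G * S.dX := by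
  rw [S.hb (t + 1) (by omega) i]
  simp only [Nat.add_sub_cancel]
  have h1 := S.hGgbound t i _ (S.x_mem t i) (S.xtil (t + 1) i - S.x t i)
  have h2 := S.norm_sub_le_dX (S.hxtilmem (t + 1) (by omega) i) (S.x_mem t i)
  have h3 := mul_le_mul_of_nonneg_left h2 S.hG.le
  have h4 := S.hgbound t i _ (S.x_mem t i)
  exact (norm_add_le _ _).trans (by linarith)

lemma q_one (i : Fin n) : S.q 1 i = 0 := by
  have h0 : S.qtil 1 i = 0 := by
    rw [S.qtil_succ 0]
    simp [mix, S.hq0]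
  rw [S.hq 1 le_rfl i, h0]
  ext j
  rw [posPart_apply]
  have h1 : S.b 1 i j ≤ 0 := by
    have := S.b_succ_le 0 i j
    rwa [S.hg0] at this
  simpa using mul_nonpos_of_nonneg_of_nonpos (S.hγpos 1 le_rfl).le h1

lemma beta_mul_norm_q_le (hγβ : ∀ t, 1 ≤ t → S.γ t * S.β t ≤ 1) (t : ℕ) (i : Fin n)
    (h : S.β (t + 1) * ‖S.qtil (t + 1) i‖ ≤ S.F) : S.β (t + 1) * ‖S.q (t + 1) i‖ ≤ S.F := by
  have hβ := S.hβpos (t + 1) (by omega)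
  have hγ := S.hγpos (t + 1) (by omega)
  have hγβ := hγβ (t + 1) (by omega)
  set γ := S.γ (t + 1)
  set β := S.β (t + 1)
  set qt := S.qtil (t + 1) i
  set g := S.g t i (S.xtil (t + 1) i)
  have h1 : ‖S.q (t + 1) i‖ ≤ ‖(1 - γ * β) • qt + γ • g‖ := by
    refine norm_le_norm_of_abs_le fun j => ?_
    rw [abs_of_nonneg (S.q_nonneg _ _ _), S.hq (t + 1) (by omega) i, posPart_apply]
    refine max_le ?_ (abs_nonneg _)
    refine le_trans ?_ (le_abs_self _)
    have := mul_le_mul_of_nonneg_left (S.b_succ_le t i j) hγ.le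
    simp only [PiLp.add_apply, PiLp.smul_apply, PiLp.sub_apply, smul_eq_mul]
    linarith
  have h2 : ‖(1 - γ * β) • qt + γ • g‖ ≤ (1 - γ * β) * ‖qt‖ + γ * S.F := by
    refine (norm_add_le _ _).trans ?_
    rw [norm_smul, norm_smul, Real.norm_of_nonneg (by linarith), Real.norm_of_nonneg hγ.le]
    have := S.hgbound t i _ (S.hxtilmem (t + 1) (by omega) i)
    gcongr
  have h3 := mul_le_mul_of_nonneg_left (h1.trans h2) hβ.le
  have h4 := mul_le_mul_of_nonneg_left h (sub_nonneg.2 hγβ)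
  linarith

/-- The dual variables are bounded by `F / β_t`. -/
lemma beta_mul_norm_qtil_le (hγβ : ∀ t, 1 ≤ t → S.γ t * S.β t ≤ 1) (t : ℕ) (i : Fin n) :
    S.β (t + 1) * ‖S.qtil (t + 1) i‖ ≤ S.F := by
  induction t generalizing i with
  | zero =>
    rw [S.qtil_succ 0]
    simp [mix, S.hq0, S.hF.le]
  | succ t ih =>
    have hβ := S.hβpos (t + 1 + 1) (by omega)
    have hanti := S.hβanti (t + 1) (t + 1 + 1) (by omega) (by omega)
    rw [qtil_succ]
    calc S.β (t + 1 + 1) * ‖mix (S.W (t + 1)) (S.q (t + 1)) i‖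
        ≤ S.β (t + 1 + 1) * ∑ j, S.W (t + 1) i j * ‖S.q (t + 1) j‖ := by
          refine mul_le_mul_of_nonneg_left ((norm_sum_le _ _).trans ?_) hβ.le
          refine Finset.sum_le_sum fun j _ => ?_
          rw [norm_smul, Real.norm_of_nonneg (S.hWnonneg _ _ _)]
      _ = ∑ j, S.W (t + 1) i j * (S.β (t + 1 + 1) * ‖S.q (t + 1) j‖) := by
          rw [Finset.mul_sum]
          exact Finset.sum_congr rfl fun j _ => by ring
      _ ≤ ∑ j, S.W (t + 1) i j * S.F := by
          refine Finset.sum_le_sum fun j _ => mul_le_mul_of_nonneg_left ?_ (S.hWnonneg _ _ _)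
          exact (mul_le_mul_of_nonneg_right hanti (norm_nonneg _)).trans
            (S.beta_mul_norm_q_le hγβ t j (ih j))
      _ = S.F := by rw [← Finset.sum_mul, S.hWrow, one_mul]

lemma norm_dual_direction_le (hγβ : ∀ t, 1 ≤ t → S.γ t * S.β t ≤ 1) (t : ℕ) (i : Fin n) :
    ‖S.b (t + 1) i - S.β (t + 1) • S.qtil (t + 1) i‖ ≤ S.B1 := by
  have h1 := S.norm_b_succ_le t i
  have h2 := S.beta_mul_norm_qtil_le hγβ t i
  refine (norm_sub_le _ _).trans ?_
  rw [norm_smul, Real.norm_of_nonneg (S.hβpos (t + 1) (by omega)).le]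
  unfold B1
  linarith

lemma norm_q_sub_qtil_le (hγβ : ∀ t, 1 ≤ t → S.γ t * S.β t ≤ 1) (hγ1 : ∀ t, 1 ≤ t → S.γ t ≤ 1)
    (t : ℕ) (i : Fin n) : ‖S.q (t + 1) i - S.qtil (t + 1) i‖ ≤ S.B1 := by
  have hγ := S.hγpos (t + 1) (by omega)
  rw [S.hq (t + 1) (by omega) i]
  refine (norm_posPart_sub_le (S.qtil_nonneg t i)).trans ?_
  rw [add_sub_cancel_left, norm_smul, Real.norm_of_nonneg hγ.le]
  exact (mul_le_mul (hγ1 _ (by omega)) (S.norm_dual_direction_le hγβ t i) (norm_nonneg _)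
    zero_le_one).trans_eq (one_mul _)

/-- Total disagreement of the averaged dual variables. -/
lemma sum_norm_center_qtil_le (hγβ : ∀ t, 1 ≤ t → S.γ t * S.β t ≤ 1)
    (hγ1 : ∀ t, 1 ≤ t → S.γ t ≤ 1) (t : ℕ) :
    ∑ i, ‖center (S.qtil (t + 1)) i‖ ≤ 4 * (n : ℝ) ^ 4 * S.iota * S.B1 / S.w := by
  have h := l2_center_le_of_perturbed S.hWnonneg S.hWrow S.hWcol S.hw0 S.hw1.le S.hWdiag S.hWpos
    S.hiota S.hconn S.hn S.B1_pos.le (funext S.hq0)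
    (fun s i => by rw [← S.qtil_succ]; exact S.norm_q_sub_qtil_le hγβ hγ1 s i) t
  have h2 : l2 (center (S.qtil (t + 1))) ≤ l2 (center (S.q t)) := by
    rw [qtil_succ, center_mix (S.hWrow t) (S.hWcol t)]
    exact l2_mix_le (S.hWnonneg t) (S.hWrow t) (S.hWcol t) _
  calc ∑ i, ‖center (S.qtil (t + 1)) i‖ ≤ √n * l2 (center (S.qtil (t + 1))) := sum_norm_le_l2 _
    _ ≤ √n * (4 * (n : ℝ) ^ 3 * S.iota * (√n * S.B1) / S.w) := by gcongr; exact h2.trans h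
    _ = 4 * (n : ℝ) ^ 3 * S.iota * ((√n * √n) * S.B1) / S.w := by ring
    _ = 4 * (n : ℝ) ^ 4 * S.iota * S.B1 / S.w := by
      rw [Real.mul_self_sqrt (Nat.cast_nonneg n)]; ring

lemma mixing_constant_le :
    4 * (n : ℝ) ^ 4 * S.iota * S.B1 / S.w ≤ 3 * (n : ℝ) ^ 2 * S.tau * S.B1 / (1 - S.lam) := by
  have hn : (1 : ℝ) ≤ n := by exact_mod_cast S.hn
  have hw := S.hw0
  have hB := S.B1_pos
  have hι : (0 : ℝ) < S.iota := by exact_mod_cast S.hiota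
  set a := S.w / (2 * (n : ℝ) ^ 2) with ha
  have ha0 : 0 < a := by positivity
  have ha1 : a < 1 := by
    rw [ha, div_lt_one (by positivity)]
    nlinarith [S.hw1, one_le_pow₀ hn (n := 2)]
  have hlam : S.lam = (1 - a) ^ ((S.iota : ℝ))⁻¹ := rfl
  have htau : S.tau = ((1 - a) ^ 2)⁻¹ := rfl
  have hlam0 : 0 < S.lam := by rw [hlam]; exact Real.rpow_pos_of_pos (by linarith) _
  have hlam1 : S.lam < 1 := by
    rw [hlam]; exact Real.rpow_lt_one (by linarith) (by linarith) (by positivity)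
  have hpow : S.lam ^ S.iota = 1 - a := by
    rw [hlam]
    exact Real.rpow_inv_natCast_pow (by linarith) S.hiota.ne'
  have hb : 1 + S.iota * (S.lam⁻¹ - 1) ≤ (1 - a)⁻¹ := by
    rw [← hpow, ← inv_pow]
    have hinv : 0 < S.lam⁻¹ := by positivity
    have h := one_add_mul_le_pow (a := S.lam⁻¹ - 1) (by linarith) S.iota
    rwa [add_sub_cancel] at h
  have h1 : S.iota * (1 - S.lam) ≤ a / (1 - a) := by
    have h2 : 1 - S.lam ≤ S.lam⁻¹ - 1 := by
      have := mul_inv_cancel₀ hlam0.ne'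
      have : 0 ≤ (1 - S.lam) * (S.lam⁻¹ - 1) :=
        mul_nonneg (by linarith) (by linarith [(one_le_inv₀ hlam0).2 hlam1.le])
      nlinarith
    have h3 : (1 - a)⁻¹ - 1 = a / (1 - a) := by
      have : 1 - a ≠ 0 := by linarith
      field_simp; ring
    have h4 := mul_le_mul_of_nonneg_left h2 hι.le
    linarith
  have h5 : a / (1 - a) ≤ a * S.tau := by
    rw [htau, div_eq_mul_inv]
    refine mul_le_mul_of_nonneg_left ?_ ha0.le
    exact inv_anti₀ (by nlinarith) (by nlinarith)
  have h6 : S.iota / a ≤ S.tau / (1 - S.lam) := by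
    rw [div_le_div_iff₀ ha0 (by linarith)]
    linarith
  have h7 : 4 * (n : ℝ) ^ 4 * S.iota * S.B1 / S.w = 2 * (n : ℝ) ^ 2 * S.B1 * (S.iota / a) := by
    rw [ha]; field_simp; ring
  have h8 : 0 ≤ S.iota / a := by positivity
  calc 4 * (n : ℝ) ^ 4 * S.iota * S.B1 / S.w = 2 * (n : ℝ) ^ 2 * S.B1 * (S.iota / a) := h7
    _ ≤ 3 * (n : ℝ) ^ 2 * S.B1 * (S.tau / (1 - S.lam)) := by gcongr; norm_num
    _ = _ := by ring

/-- Consequence of primal optimality for one agent. -/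
lemma inner_qtil_b_le (t : ℕ) {i : Fin n} {y : EuclideanSpace ℝ (Fin (p i))} (hy : y ∈ S.X i)
    {ε : ℝ} (hε : 0 < ε) :
    ⟪S.qtil (t + 1) i, S.b (t + 1) i⟫ ≤ ⟪S.qtil (t + 1) i, S.g t i y⟫ + 2 * S.F
      + S.G ^ 2 / (2 * ε * S.sigmin) + ε * breg (S.ψ i) (S.ψ' i) y (S.xtil (t + 1) i)
      + (S.α (t + 1))⁻¹ * (breg (S.ψ i) (S.ψ' i) y (S.x t i)
          - breg (S.ψ i) (S.ψ' i) y (S.xtil (t + 1) i))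
      - (S.α (t + 1))⁻¹ * (S.sigmin / 2 * ‖S.xtil (t + 1) i - S.x t i‖ ^ 2) := by
  have hα := S.hαpos (t + 1) (by omega)
  have hx := S.x_mem t i
  have hxt := S.hxtilmem (t + 1) (by omega) i
  have hσ := S.sigmin_pos
  set α := S.α (t + 1)
  set x := S.x t i with hxdef
  set z := S.xtil (t + 1) i with hzdef
  set q := S.qtil (t + 1) i with hqdef
  have hstep := mirror_step (S.hXconvex i) (S.hrconvex t i) hα.le (S.hψgrad i z) hxt
    (S.hxtilmin (t + 1) (by omega) i) hy
  simp only [Nat.add_sub_cancel, ← hxdef] at hstep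
  have hB := S.sigmin_mul_le_breg hxt hx
  have h1 : ⟪z - y, S.a (t + 1) i⟫ + S.r t i z - S.r t i y ≤
      α⁻¹ * (breg (S.ψ i) (S.ψ' i) y x - breg (S.ψ i) (S.ψ' i) y z)
        - α⁻¹ * (S.sigmin / 2 * ‖z - x‖ ^ 2) := by
    rw [← mul_sub, le_inv_mul_iff₀ hα]
    linarith
  have ha : ⟪z - y, S.a (t + 1) i⟫
      = ⟪z - y, S.Gf t i x⟫ + ∑ j, q j * ⟪S.Gg t i x j, z - y⟫ := by
    rw [S.ha (t + 1) (by omega) i, inner_add_right, inner_sum]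
    simp only [Nat.add_sub_cancel, real_inner_smul_right, real_inner_comm (z - y)]
    rfl
  have hq : ⟪q, S.b (t + 1) i⟫ ≤ ⟪q, S.g t i y⟫ + ∑ j, q j * ⟪S.Gg t i x j, z - y⟫ := by
    rw [inner_eq_sum_mul, inner_eq_sum_mul, ← Finset.sum_add_distrib]
    refine Finset.sum_le_sum fun j _ => ?_
    rw [← mul_add, b_succ_apply]
    refine mul_le_mul_of_nonneg_left ?_ (S.qtil_nonneg t i j)
    have hs := S.hGgsub t i x hx j y hy
    have : z - x = (z - y) + (y - x) := by abel
    rw [← hzdef, ← hxdef, this, inner_add_right]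
    linarith
  have hf : -⟪z - y, S.Gf t i x⟫ ≤ S.G * ‖y - z‖ := by
    rw [← inner_neg_left, neg_sub, mul_comm]
    exact (real_inner_le_norm _ _).trans
      (mul_le_mul_of_nonneg_left (S.hGfbound t i x hx) (norm_nonneg _))
  have hyoung : S.G * ‖y - z‖ ≤ S.G ^ 2 / (2 * ε * S.sigmin)
      + ε * (S.sigmin / 2 * ‖y - z‖ ^ 2) := by
    have : S.G ^ 2 / (2 * ε * S.sigmin) + ε * (S.sigmin / 2 * ‖y - z‖ ^ 2) - S.G * ‖y - z‖
        = (S.G - ε * S.sigmin * ‖y - z‖) ^ 2 / (2 * ε * S.sigmin) := by field_simp; ring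
    have : 0 ≤ (S.G - ε * S.sigmin * ‖y - z‖) ^ 2 / (2 * ε * S.sigmin) := by positivity
    linarith
  have hD := mul_le_mul_of_nonneg_left (S.sigmin_mul_le_breg hy hxt) hε.le
  have hr1 := abs_le.1 (S.hrbound t i z hxt)
  have hr2 := abs_le.1 (S.hrbound t i y hy)
  linarith

/-- One dual step for one agent, measured against a nonnegative reference `v`. -/
lemma inner_g_le (hγβ : ∀ t, 1 ≤ t → S.γ t * S.β t ≤ 1) (hγ1 : ∀ t, 1 ≤ t → S.γ t ≤ 1)
    (t : ℕ) {i : Fin n} {y : EuclideanSpace ℝ (Fin (p i))} (hy : y ∈ S.X i)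
    {ε : ℝ} (hε : 0 < ε) {v : EuclideanSpace ℝ (Fin m)} (hv : ∀ j, 0 ≤ v j) :
    ⟪v, S.g t i (S.x t i)⟫ ≤
      (((S.γ (t + 1))⁻¹ - S.β (t + 1)) * ‖S.qtil (t + 1) i - v‖ ^ 2
        - (S.γ (t + 1))⁻¹ * ‖S.q (t + 1) i - v‖ ^ 2) / 2
      + ‖v‖ ^ 2 / 2 * (S.β (t + 1) + S.G ^ 2 / S.sigmin * S.α (t + 1))
      + S.B1 ^ 2 / 2 + ⟪S.qtil (t + 1) i, S.g t i y⟫ + 2 * S.F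
      + S.G ^ 2 / (2 * ε * S.sigmin) + ε * breg (S.ψ i) (S.ψ' i) y (S.xtil (t + 1) i)
      + (S.α (t + 1))⁻¹ * (breg (S.ψ i) (S.ψ' i) y (S.x t i)
          - breg (S.ψ i) (S.ψ' i) y (S.xtil (t + 1) i)) := by
  have hprimal := S.inner_qtil_b_le t hy hε
  have hα := S.hαpos (t + 1) (by omega)
  have hγ := S.hγpos (t + 1) (by omega)
  have hγ1 := hγ1 (t + 1) (by omega)
  have hσ := S.sigmin_pos
  have hdir := S.norm_dual_direction_le hγβ t i
  have hq : ‖S.q (t + 1) i - v‖ ≤ ‖(S.qtil (t + 1) i - v)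
      + S.γ (t + 1) • (S.b (t + 1) i - S.β (t + 1) • S.qtil (t + 1) i)‖ := by
    rw [S.hq (t + 1) (by omega) i]
    refine (norm_posPart_sub_le hv).trans_eq ?_
    congr 1
    abel
  have hb : -⟪v, S.b (t + 1) i⟫
      ≤ -⟪v, S.g t i (S.x t i)⟫ + ‖v‖ * (S.G * ‖S.xtil (t + 1) i - S.x t i‖) := by
    rw [S.hb (t + 1) (by omega) i, inner_add_right]
    simp only [Nat.add_sub_cancel]
    have h1 := S.hGgbound t i _ (S.x_mem t i) (S.xtil (t + 1) i - S.x t i)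
    have h2 := (abs_le.1 (abs_real_inner_le_norm v (vecOf fun j =>
      ⟪S.Gg t i (S.x t i) j, S.xtil (t + 1) i - S.x t i⟫))).1
    have h3 := mul_le_mul_of_nonneg_left h1 (norm_nonneg v)
    linarith
  set α := S.α (t + 1)
  set γ := S.γ (t + 1)
  set β := S.β (t + 1)
  set q := S.qtil (t + 1) i
  set b := S.b (t + 1) i
  set δ := ‖S.xtil (t + 1) i - S.x t i‖
  have hsq : ‖S.q (t + 1) i - v‖ ^ 2 ≤ ‖q - v‖ ^ 2 + 2 * γ * ⟪q - v, b - β • q⟫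
      + γ ^ 2 * ‖b - β • q‖ ^ 2 := by
    refine (pow_le_pow_left₀ (norm_nonneg _) hq 2).trans_eq ?_
    rw [norm_add_sq_real, real_inner_smul_right, norm_smul, Real.norm_of_nonneg hγ.le]
    ring
  have hin : 2 * ⟪q - v, b - β • q⟫ = 2 * ⟪q, b⟫ - 2 * ⟪v, b⟫
      + β * (‖v‖ ^ 2 - ‖q‖ ^ 2 - ‖q - v‖ ^ 2) := by
    rw [norm_sub_sq_real, inner_sub_left, inner_sub_right, inner_sub_right,
      real_inner_smul_right, real_inner_smul_right, real_inner_self_eq_norm_sq,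
      real_inner_comm q v]
    ring
  have hβ := S.hβpos (t + 1) (by omega)
  have hdir2 : γ * ‖b - β • q‖ ^ 2 ≤ S.B1 ^ 2 := by
    have h1 := pow_le_pow_left₀ (norm_nonneg _) hdir 2
    have h2 := mul_le_mul_of_nonneg_right hγ1 (sq_nonneg ‖b - β • q‖)
    linarith
  have hdual : γ⁻¹ * ‖S.q (t + 1) i - v‖ ^ 2 ≤ (γ⁻¹ - β) * ‖q - v‖ ^ 2
      + 2 * ⟪q, b⟫ - 2 * ⟪v, b⟫ + β * ‖v‖ ^ 2 + S.B1 ^ 2 := by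
    have h1 := mul_le_mul_of_nonneg_left hsq (inv_pos.2 hγ).le
    have h2 : γ⁻¹ * (‖q - v‖ ^ 2 + 2 * γ * ⟪q - v, b - β • q⟫ + γ ^ 2 * ‖b - β • q‖ ^ 2)
        = γ⁻¹ * ‖q - v‖ ^ 2 + 2 * ⟪q - v, b - β • q⟫ + γ * ‖b - β • q‖ ^ 2 := by
      field_simp
    have h3 : 0 ≤ β * ‖q‖ ^ 2 := mul_nonneg hβ.le (sq_nonneg _)
    rw [h2, hin] at h1
    linarith
  have hyoung : ‖v‖ * (S.G * δ) - α⁻¹ * (S.sigmin / 2 * δ ^ 2)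
      ≤ ‖v‖ ^ 2 / 2 * (S.G ^ 2 / S.sigmin * α) := by
    have : ‖v‖ ^ 2 / 2 * (S.G ^ 2 / S.sigmin * α)
        - (‖v‖ * (S.G * δ) - α⁻¹ * (S.sigmin / 2 * δ ^ 2))
        = (‖v‖ * S.G * α - S.sigmin * δ) ^ 2 / (2 * α * S.sigmin) := by field_simp; ring
    have : 0 ≤ (‖v‖ * S.G * α - S.sigmin * δ) ^ 2 / (2 * α * S.sigmin) := by positivity
    linarith
  linarith

end Alg

/-! ### Power sums and stepsize comparisons -/

section Rpow

lemma rpow_sub_one_mul_le {c : ℝ} (hc0 : 0 ≤ c) (hc1 : c < 1) {t : ℝ} (ht : 0 ≤ t) :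
    (1 - c) * ((t + 1) ^ c)⁻¹ ≤ (t + 1) ^ (1 - c) - t ^ (1 - c) := by
  have ht1 : 0 < t + 1 := by linarith
  have hB := rpow_one_add_le_one_add_mul_self (s := -(t + 1)⁻¹) (p := 1 - c)
    (by linarith [(inv_le_one₀ ht1).2 (by linarith)]) (by linarith) (by linarith)
  have h1 : (t + 1) ^ (1 - c) * (1 + -(t + 1)⁻¹) ^ (1 - c) = t ^ (1 - c) := by
    have h : 1 + -(t + 1)⁻¹ = t / (t + 1) := by field_simp; ring
    rw [h, ← Real.mul_rpow ht1.le (by positivity)]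
    congr 1
    field_simp
  have h2 : (t + 1) ^ (1 - c) * (t + 1)⁻¹ = ((t + 1) ^ c)⁻¹ := by
    rw [← Real.rpow_neg_one, ← Real.rpow_add ht1, ← Real.rpow_neg ht1.le]
    congr 1
    ring
  have h3 := mul_le_mul_of_nonneg_left hB (Real.rpow_nonneg ht1.le (1 - c))
  rw [h1] at h3
  linear_combination h3 - (1 - c) * h2

lemma sum_inv_rpow_le {c : ℝ} (hc0 : 0 ≤ c) (hc1 : c < 1) (T : ℕ) :
    ∑ t ∈ Finset.Icc 1 T, (((t + 1 : ℕ) : ℝ) ^ c)⁻¹ ≤ (T : ℝ) ^ (1 - c) / (1 - c) := by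
  induction T with
  | zero => simp [Real.zero_rpow (by linarith : 1 - c ≠ 0)]
  | succ T ih =>
    have hc : 0 < 1 - c := by linarith
    rw [Finset.sum_Icc_succ_top (by omega)]
    have h1 := rpow_sub_one_mul_le hc0 hc1 (Nat.cast_nonneg (α := ℝ) T)
    have h2 : (((T + 1 + 1 : ℕ) : ℝ) ^ c)⁻¹ ≤ (((T : ℝ) + 1) ^ c)⁻¹ := by
      refine inv_anti₀ (by positivity) (Real.rpow_le_rpow (by positivity) ?_ hc0)
      push_cast
      linarith
    rw [le_div_iff₀ hc] at ih ⊢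
    push_cast at *
    nlinarith

lemma rpow_sub_inv_rpow_le {c : ℝ} (hc0 : 0 ≤ c) {t : ℝ} (ht : 0 < t) :
    (t + 1) ^ (1 - c) - ((t + 1) ^ c)⁻¹ ≤ t ^ (1 - c) := by
  have ht1 : 0 < t + 1 := by linarith
  have h1 : (t + 1) ^ (1 - c) = (t + 1) * ((t + 1) ^ c)⁻¹ := by
    rw [Real.rpow_sub ht1, Real.rpow_one, div_eq_mul_inv]
  have h2 : t ^ (1 - c) = t * (t ^ c)⁻¹ := by
    rw [Real.rpow_sub ht, Real.rpow_one, div_eq_mul_inv]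
  have h3 : ((t + 1) ^ c)⁻¹ ≤ (t ^ c)⁻¹ :=
    inv_anti₀ (Real.rpow_pos_of_pos ht c) (Real.rpow_le_rpow ht.le (by linarith) hc0)
  rw [h1, h2]
  nlinarith

lemma add_one_rpow_le {c : ℝ} (hc0 : 0 ≤ c) (hc1 : c ≤ 1) {t : ℝ} (ht : 1 ≤ t) :
    (t + 1) ^ c ≤ (1 + c) * t := by
  have h := rpow_one_add_le_one_add_mul_self (s := t) (by linarith) hc0 hc1
  rw [add_comm t 1]
  nlinarith

end Rpow

namespace Alg

variable {n m : ℕ} {p : Fin n → ℕ} (S : Alg n m p)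

/-- Total Bregman divergence from a fixed comparator to the iterate. -/
def bregSum (y : ∀ i, EuclideanSpace ℝ (Fin (p i))) (t : ℕ) : ℝ :=
  ∑ i, breg (S.ψ i) (S.ψ' i) (y i) (S.x t i)

lemma bregSum_le {y : ∀ i, EuclideanSpace ℝ (Fin (p i))} (hy : ∀ i, y i ∈ S.X i) (t : ℕ) :
    S.bregSum y t ≤ n * S.dX * S.K := by
  calc S.bregSum y t ≤ ∑ _i : Fin n, S.K * S.dX :=
        Finset.sum_le_sum fun i _ => S.breg_le (hy i) (S.x_mem t i)
    _ = n * S.dX * S.K := by simp; ring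

lemma bregSum_nonneg {y : ∀ i, EuclideanSpace ℝ (Fin (p i))} (hy : ∀ i, y i ∈ S.X i) (t : ℕ) :
    0 ≤ S.bregSum y t :=
  Finset.sum_nonneg fun i _ => S.breg_nonneg (hy i) (S.x_mem t i)

lemma sum_inner_qtil_le (hγβ : ∀ t, 1 ≤ t → S.γ t * S.β t ≤ 1) (hγ1 : ∀ t, 1 ≤ t → S.γ t ≤ 1)
    (t : ℕ) {y : ∀ i, EuclideanSpace ℝ (Fin (p i))} (hy : ∀ i, y i ∈ S.X i)
    (hfeas : ∀ j, S.gsum t y j ≤ 0) :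
    ∑ i, ⟪S.qtil (t + 1) i, S.g t i (y i)⟫
      ≤ 3 * (n : ℝ) ^ 2 * S.tau * S.B1 * S.F / (1 - S.lam) := by
  set c := (n : ℝ)⁻¹ • ∑ i, S.qtil (t + 1) i with hc
  have h1 : ∑ i, ⟪S.qtil (t + 1) i, S.g t i (y i)⟫
      = ∑ i, ⟪center (S.qtil (t + 1)) i, S.g t i (y i)⟫ + ⟪c, S.gsum t y⟫ := by
    rw [gsum, inner_sum, ← Finset.sum_add_distrib]
    refine Finset.sum_congr rfl fun i _ => ?_
    rw [← inner_add_left]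
    simp [center, hc]
  have h2 : ⟪c, S.gsum t y⟫ ≤ 0 := by
    rw [inner_eq_sum_mul]
    refine Finset.sum_nonpos fun j _ => mul_nonpos_of_nonneg_of_nonpos ?_ (hfeas j)
    have : 0 ≤ ∑ i, S.qtil (t + 1) i j := Finset.sum_nonneg fun i _ => S.qtil_nonneg t i j
    simp only [hc, PiLp.smul_apply, smul_eq_mul, WithLp.ofLp_sum, Finset.sum_apply]
    positivity
  have h3 : ∑ i, ⟪center (S.qtil (t + 1)) i, S.g t i (y i)⟫
      ≤ (∑ i, ‖center (S.qtil (t + 1)) i‖) * S.F := by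
    rw [Finset.sum_mul]
    exact Finset.sum_le_sum fun i _ => (real_inner_le_norm _ _).trans
      (mul_le_mul_of_nonneg_left (S.hgbound t i _ (hy i)) (norm_nonneg _))
  have h4 := mul_le_mul_of_nonneg_right
    ((S.sum_norm_center_qtil_le hγβ hγ1 t).trans S.mixing_constant_le) S.hF.le
  have h5 : 3 * (n : ℝ) ^ 2 * S.tau * S.B1 / (1 - S.lam) * S.F
      = 3 * (n : ℝ) ^ 2 * S.tau * S.B1 * S.F / (1 - S.lam) := by ring
  linarith

/-- One step of the joint primal-dual recursion, summed over agents. -/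
lemma inner_gsum_le (hΦid : ∀ t i (z : EuclideanSpace ℝ (Fin (p i))), S.Φ t i z = z)
    (hγβ : ∀ t, 1 ≤ t → S.γ t * S.β t ≤ 1) (hγ1 : ∀ t, 1 ≤ t → S.γ t ≤ 1)
    (t : ℕ) {y : ∀ i, EuclideanSpace ℝ (Fin (p i))} (hy : ∀ i, y i ∈ S.X i)
    (hfeas : ∀ j, S.gsum t y j ≤ 0) {ε : ℝ} (hε : 0 < ε)
    {v : EuclideanSpace ℝ (Fin m)} (hv : ∀ j, 0 ≤ v j) :
    ⟪v, S.gsum t (S.x t)⟫ ≤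
      (((S.γ (t + 1))⁻¹ - S.β (t + 1)) * l2 (fun i => S.q t i - v) ^ 2
        - (S.γ (t + 1))⁻¹ * l2 (fun i => S.q (t + 1) i - v) ^ 2) / 2
      + n * ‖v‖ ^ 2 / 2 * (S.β (t + 1) + S.G ^ 2 / S.sigmin * S.α (t + 1))
      + (S.C11 + 2 * n * S.F + n * S.G ^ 2 / (2 * ε * S.sigmin))
      + ε * S.bregSum y (t + 1)
      + (S.α (t + 1))⁻¹ * (S.bregSum y t - S.bregSum y (t + 1)) := by
  have h := Finset.sum_le_sum fun i (_ : i ∈ Finset.univ) =>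
    S.inner_g_le hγβ hγ1 t (hy i) hε hv
  simp only [Finset.sum_add_distrib, Finset.sum_sub_distrib, ← Finset.mul_sum,
    ← Finset.sum_div, Finset.sum_const, Finset.card_univ, Fintype.card_fin, nsmul_eq_mul,
    S.xtil_eq_x hΦid (Nat.succ_pos t)] at h
  have hmix : ∑ i, ‖S.qtil (t + 1) i - v‖ ^ 2 ≤ l2 (fun i => S.q t i - v) ^ 2 := by
    have h1 : (fun i => S.qtil (t + 1) i - v) = mix (S.W t) (fun i => S.q t i - v) := by
      rw [qtil_succ]
      ext1 i
      simp [mix, smul_sub, Finset.sum_sub_distrib, ← Finset.sum_smul, S.hWrow]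
    rw [← l2_sq (fun i => S.qtil (t + 1) i - v), h1]
    exact pow_le_pow_left₀ (l2_nonneg _)
      (l2_mix_le (S.hWnonneg t) (S.hWrow t) (S.hWcol t) _) 2
  have hcoef : 0 ≤ (S.γ (t + 1))⁻¹ - S.β (t + 1) := by
    have hγ := S.hγpos (t + 1) (by omega)
    rw [sub_nonneg, ← one_div, le_div_iff₀ hγ, mul_comm]
    exact hγβ _ (by omega)
  have hmix' := mul_le_mul_of_nonneg_left hmix hcoef
  have hqt := S.sum_inner_qtil_le hγβ hγ1 t hy hfeas
  rw [gsum, inner_sum, l2_sq (fun i => S.q (t + 1) i - v)]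
  unfold C11 bregSum
  linear_combination h + hmix' / 2 + hqt

end Alg

namespace Alg

variable {n m : ℕ} {p : Fin n → ℕ} (S : Alg n m p)

/-- The primal-dual recursion accumulated over `N` steps with polynomial stepsizes. -/
lemma inner_sum_gsum_le (hΦid : ∀ t i (z : EuclideanSpace ℝ (Fin (p i))), S.Φ t i z = z)
    {κ c : ℝ} (hκ0 : 0 < κ) (hκ1 : κ < 1) (hc0 : 0 ≤ c)
    (hα : ∀ t : ℕ, 1 ≤ t → S.α t = ((t : ℝ) ^ c)⁻¹)
    (hβ : ∀ t : ℕ, 1 ≤ t → S.β t = ((t : ℝ) ^ κ)⁻¹)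
    (hγ : ∀ t : ℕ, 1 ≤ t → S.γ t = ((t : ℝ) ^ (1 - κ))⁻¹)
    {y : ∀ i, EuclideanSpace ℝ (Fin (p i))} (hy : ∀ i, y i ∈ S.X i) {ε : ℝ} (hε : 0 < ε)
    {v : EuclideanSpace ℝ (Fin m)} (hv : ∀ j, 0 ≤ v j) (N : ℕ)
    (hfeas : ∀ t ∈ Finset.Icc 1 N, ∀ j, S.gsum t y j ≤ 0) :
    ∑ t ∈ Finset.Icc 1 N, ⟪v, S.gsum t (S.x t)⟫ ≤
      n * ‖v‖ ^ 2 / 2 - ((N + 1 : ℕ) : ℝ) ^ (1 - κ) * l2 (fun i => S.q (N + 1) i - v) ^ 2 / 2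
      + n * ‖v‖ ^ 2 / 2 * (∑ t ∈ Finset.Icc 1 N, (((t + 1 : ℕ) : ℝ) ^ κ)⁻¹
        + S.G ^ 2 / S.sigmin * ∑ t ∈ Finset.Icc 1 N, (((t + 1 : ℕ) : ℝ) ^ c)⁻¹)
      + N * (S.C11 + 2 * n * S.F + n * S.G ^ 2 / (2 * ε * S.sigmin) + ε * (n * S.dX * S.K))
      + ((N + 1 : ℕ) : ℝ) ^ c * (n * S.dX * S.K - S.bregSum y (N + 1)) := by
  have hγ1 : ∀ t, 1 ≤ t → S.γ t ≤ 1 := fun t ht => by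
    rw [hγ t ht]
    exact inv_le_one_of_one_le₀ (Real.one_le_rpow (by exact_mod_cast ht) (by linarith))
  have hγβ : ∀ t, 1 ≤ t → S.γ t * S.β t ≤ 1 := fun t ht => by
    refine mul_le_one₀ (hγ1 t ht) (S.hβpos t ht).le ?_
    rw [hβ t ht]
    exact inv_le_one_of_one_le₀ (Real.one_le_rpow (by exact_mod_cast ht) hκ0.le)
  induction N with
  | zero =>
    have h := S.bregSum_le hy 1
    simp [l2_sq, S.q_one, h]
  | succ N ih =>
    have ih := ih fun t ht => hfeas t (Finset.Icc_subset_Icc_right (Nat.le_succ N) ht)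
    have hstep := S.inner_gsum_le hΦid hγβ hγ1 (N + 1) hy
      (hfeas (N + 1) (Finset.mem_Icc.2 ⟨by omega, le_rfl⟩)) hε hv
    rw [hα (N + 1 + 1) (by omega), hβ (N + 1 + 1) (by omega), hγ (N + 1 + 1) (by omega),
      inv_inv, inv_inv] at hstep
    simp only [Finset.sum_Icc_succ_top (Nat.le_add_left 1 N)]
    have hcoef := mul_le_mul_of_nonneg_right
      (rpow_sub_inv_rpow_le hκ0.le (t := ((N + 1 : ℕ) : ℝ)) (by positivity))
      (sq_nonneg (l2 fun i => S.q (N + 1) i - v))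
    rw [← Nat.cast_add_one] at hcoef
    have hpow : ((N + 1 : ℕ) : ℝ) ^ c ≤ ((N + 1 + 1 : ℕ) : ℝ) ^ c :=
      Real.rpow_le_rpow (by positivity) (by push_cast; linarith) hc0
    have hD1 := mul_nonneg (sub_nonneg.2 hpow) (sub_nonneg.2 (S.bregSum_le hy (N + 1)))
    have hD2 := mul_le_mul_of_nonneg_left (S.bregSum_le hy (N + 1 + 1)) hε.le
    have hcast : ((N + 1 : ℕ) : ℝ) = N + 1 := Nat.cast_add_one N
    have hNC : ((N + 1 : ℕ) : ℝ) * (S.C11 + 2 * n * S.F + n * S.G ^ 2 / (2 * ε * S.sigmin)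
          + ε * (n * S.dX * S.K))
        = N * (S.C11 + 2 * n * S.F + n * S.G ^ 2 / (2 * ε * S.sigmin) + ε * (n * S.dX * S.K))
          + (S.C11 + 2 * n * S.F + n * S.G ^ 2 / (2 * ε * S.sigmin) + ε * (n * S.dX * S.K)) := by
      rw [hcast]; ring
    rw [hNC]
    linear_combination ih + hstep + hcoef / 2 + hD1 + hD2

lemma C11_nonneg : 0 ≤ S.C11 := by
  have hB := S.B1_pos
  have hF := S.hF
  have hw := S.hw0
  have h1 : 0 ≤ 3 * (n : ℝ) ^ 2 * S.tau * S.B1 / (1 - S.lam) :=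
    le_trans (by positivity) S.mixing_constant_le
  have h2 := mul_nonneg h1 hF.le
  have h3 : 0 ≤ (n : ℝ) * S.B1 ^ 2 / 2 := by positivity
  unfold C11
  linear_combination h2 + h3

end Alg

/-- Completing the square: a quadratic upper bound on all nonnegative functionals bounds the
positive part. -/
lemma norm_posPart_sq_le {d : ℕ} {s : EuclideanSpace ℝ (Fin d)} {A R : ℝ} (hA : 0 < A)
    (h : ∀ v : EuclideanSpace ℝ (Fin d), (∀ j, 0 ≤ v j) → ⟪v, s⟫ ≤ A / 4 * ‖v‖ ^ 2 + R) :
    ‖posPart s‖ ^ 2 ≤ A * R := by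
  have h1 := h ((2 / A) • posPart s) fun j => by
    simp only [PiLp.smul_apply, smul_eq_mul, posPart_apply]
    positivity
  rw [real_inner_smul_left, inner_posPart_self, norm_smul, Real.norm_of_nonneg (by positivity)]
    at h1
  have h2 : A * (2 / A * ‖posPart s‖ ^ 2) ≤ A * (A / 4 * (2 / A * ‖posPart s‖) ^ 2 + R) :=
    mul_le_mul_of_nonneg_left h1 hA.le
  have h3 : A * (2 / A * ‖posPart s‖ ^ 2) = 2 * ‖posPart s‖ ^ 2 := by field_simp
  have h4 : A * (A / 4 * (2 / A * ‖posPart s‖) ^ 2 + R) = ‖posPart s‖ ^ 2 + A * R := by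
    field_simp; ring
  linarith

theorem statement_15 {n m : ℕ} {p : Fin n → ℕ} (S : Alg n m p)
    (hΦid : ∀ t i (z : EuclideanSpace ℝ (Fin (p i))), S.Φ t i z = z)
    (μ : Fin n → ℝ) (hμ : ∀ i, 0 < μ i)
    (hstrconv : ∀ t : ℕ, 1 ≤ t → ∀ i, ∀ z ∈ S.X i, ∀ u ∈ S.X i,
      S.f t i u + ⟪z - u, S.Gf t i u⟫ + μ i * breg (S.ψ i) (S.ψ' i) z u ≤ S.f t i z)
    (μmin : ℝ) (hμmin : IsLeast (Set.range μ) μmin)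
    (κ : ℝ) (hκ0 : 0 < κ) (hκ1 : κ < 1)
    (hα : ∀ t : ℕ, 1 ≤ t → S.α t = ((t : ℝ) ^ max (1 - κ) κ)⁻¹)
    (hβ : ∀ t : ℕ, 1 ≤ t → S.β t = ((t : ℝ) ^ κ)⁻¹)
    (hγ : ∀ t : ℕ, 1 ≤ t → S.γ t = ((t : ℝ) ^ (1 - κ))⁻¹)
    (T : ℕ) (hT : 1 ≤ T)
    (hstatic : ∃ xc : ∀ i, EuclideanSpace ℝ (Fin (p i)),
      (∀ i, xc i ∈ S.X i) ∧ ∀ t ∈ Finset.Icc 1 T, ∀ j, S.gsum t xc j ≤ 0) :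
    S.violation T ≤
      Real.sqrt ((2 * (n : ℝ) * (2 * S.G ^ 2 / ((1 - max (1 - κ) κ) * S.sigmin) + 1 / (1 - κ) + 2)) * (2 * (n : ℝ) * S.F + (S.C11 / κ + S.C12 / (1 - max (1 - κ) κ) + 2 * (n : ℝ) * S.dX * S.K))) * (T : ℝ) ^ (1 - κ / 2) := by
  obtain ⟨y, hy, hfeas⟩ := hstatic
  set c := max (1 - κ) κ with hc
  have hc1 : c < 1 := max_lt (by linarith) hκ1
  have hcκ : 1 - κ ≤ c := le_max_left _ _
  have hcκ' : κ ≤ c := le_max_right _ _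
  have hc0 : 0 ≤ c := hκ0.le.trans hcκ'
  have hσ := S.sigmin_pos
  have hF := S.hF
  have hK := S.hK
  have hdX := S.hdX
  have hn : (1 : ℝ) ≤ n := by exact_mod_cast S.hn
  have hT' : (1 : ℝ) ≤ T := by exact_mod_cast hT
  have hε : 0 < 1 - c := by linarith
  have hκε : 0 < 1 - κ := by linarith
  set A := 2 * (n : ℝ) * (2 * S.G ^ 2 / ((1 - c) * S.sigmin) + 1 / (1 - κ) + 2) with hA
  set R := 2 * (n : ℝ) * S.F + (S.C11 / κ + S.C12 / (1 - c) + 2 * (n : ℝ) * S.dX * S.K) with hR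
  have hA0 : 0 < A := by positivity
  have hTκ : 1 ≤ (T : ℝ) ^ (1 - κ) := Real.one_le_rpow hT' hκε.le
  have hTκ0 : 0 < (T : ℝ) ^ (1 - κ) := by linarith
  have hquad : ∀ v : EuclideanSpace ℝ (Fin m), (∀ j, 0 ≤ v j) →
      ⟪v, ∑ t ∈ Finset.Icc 1 T, S.gsum t (S.x t)⟫
        ≤ A * (T : ℝ) ^ (1 - κ) / 4 * ‖v‖ ^ 2 + R * T := by
    intro v hv
    have h := S.inner_sum_gsum_le hΦid hκ0 hκ1 hc0 hα hβ hγ hy hε hv T hfeas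
    rw [inner_sum]
    have hU : 0 ≤ ((T + 1 : ℕ) : ℝ) ^ (1 - κ) * l2 (fun i => S.q (T + 1) i - v) ^ 2 / 2 := by
      positivity
    have hβsum := sum_inv_rpow_le hκ0.le hκ1 T
    have hαsum : ∑ t ∈ Finset.Icc 1 T, (((t + 1 : ℕ) : ℝ) ^ c)⁻¹
        ≤ (T : ℝ) ^ (1 - κ) / (1 - c) :=
      (sum_inv_rpow_le hc0 hc1 T).trans
        (div_le_div_of_nonneg_right (Real.rpow_le_rpow_of_exponent_le hT' (by linarith)) hε.le)
    have hv2 : 0 ≤ n * ‖v‖ ^ 2 / 2 := by positivity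
    have hquad1 : n * ‖v‖ ^ 2 / 2 + n * ‖v‖ ^ 2 / 2
          * (∑ t ∈ Finset.Icc 1 T, (((t + 1 : ℕ) : ℝ) ^ κ)⁻¹
            + S.G ^ 2 / S.sigmin * ∑ t ∈ Finset.Icc 1 T, (((t + 1 : ℕ) : ℝ) ^ c)⁻¹)
        ≤ A * (T : ℝ) ^ (1 - κ) / 4 * ‖v‖ ^ 2 := by
      have hcoef : 0 ≤ S.G ^ 2 / ((1 - c) * S.sigmin) := by positivity
      calc _ ≤ n * ‖v‖ ^ 2 / 2 * (T : ℝ) ^ (1 - κ) + n * ‖v‖ ^ 2 / 2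
            * ((T : ℝ) ^ (1 - κ) / (1 - κ)
              + S.G ^ 2 / S.sigmin * ((T : ℝ) ^ (1 - κ) / (1 - c))) := by
            gcongr
            exact le_mul_of_one_le_right hv2 hTκ
        _ = n * ‖v‖ ^ 2 / 2 * (T : ℝ) ^ (1 - κ)
              * (S.G ^ 2 / ((1 - c) * S.sigmin) + 1 / (1 - κ) + 1) := by
            field_simp; ring
        _ ≤ n * ‖v‖ ^ 2 / 2 * (T : ℝ) ^ (1 - κ)
              * (2 * (S.G ^ 2 / ((1 - c) * S.sigmin)) + 1 / (1 - κ) + 2) := by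
            gcongr <;> linarith
        _ = _ := by rw [hA]; ring
    have hM : 0 ≤ n * S.dX * S.K := by positivity
    have hlast : ((T + 1 : ℕ) : ℝ) ^ c * (n * S.dX * S.K - S.bregSum y (T + 1))
        ≤ (1 + c) * T * (n * S.dX * S.K) := by
      push_cast
      exact mul_le_mul (add_one_rpow_le hc0 hc1.le hT')
        (by linarith [S.bregSum_nonneg hy (T + 1)])
        (sub_nonneg.2 (S.bregSum_le hy (T + 1))) (by positivity)
    have hC11 : S.C11 ≤ S.C11 / κ := by
      rw [le_div_iff₀ hκ0]
      nlinarith [S.C11_nonneg]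
    have hC12 : n * S.G ^ 2 / (2 * (1 - c) * S.sigmin) ≤ S.C12 / (1 - c) := by
      have h0 : 0 ≤ n * S.G ^ 2 / ((1 - c) * S.sigmin) := by positivity
      have h1 : n * S.G ^ 2 / (2 * (1 - c) * S.sigmin)
          = n * S.G ^ 2 / ((1 - c) * S.sigmin) / 2 := by field_simp
      have h2 : S.C12 / (1 - c) = 4 * (n * S.G ^ 2 / ((1 - c) * S.sigmin)) := by
        unfold Alg.C12; field_simp
      rw [h1, h2]
      linarith
    have hRT := mul_le_mul_of_nonneg_right (add_le_add hC11 hC12) (by linarith : (0 : ℝ) ≤ T)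
    rw [hR]
    linear_combination h + hU + hquad1 + hlast + hRT
  have hsq := norm_posPart_sq_le (mul_pos hA0 hTκ0) hquad
  have hpow : (T : ℝ) ^ (1 - κ) * T = ((T : ℝ) ^ (1 - κ / 2)) ^ 2 := by
    have hTpos : (0 : ℝ) < T := by linarith
    rw [← Real.rpow_natCast, ← Real.rpow_mul hTpos.le, ← Real.rpow_add_one hTpos.ne']
    congr 1
    push_cast
    ring
  have hfin : S.violation T ^ 2 ≤ A * R * ((T : ℝ) ^ (1 - κ / 2)) ^ 2 := by
    rw [← hpow]
    unfold Alg.violation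
    linear_combination hsq
  rw [← Real.sqrt_sq (Real.rpow_nonneg (Nat.cast_nonneg (α := ℝ) T) (1 - κ / 2)),
    ← Real.sqrt_mul' _ (sq_nonneg _)]
  exact Real.le_sqrt_of_sq_le hfin

end
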